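/- arXiv:1901.10315 — 2 statements merged into one kernel-verified Lean document; each statement's English description precedes it below -/
import Mathlib

section
/- There exists a unique c in the interval [2/√3, e^{0.15325}] such that h₁(c) + 4·h₂(c) = π, where h₁(c) = ∫_{π/3}^{2π/3} (1 − R⁻(c·sin ψ)²)⁻¹ dψ and h₂(c) = ∫_{R⁻((√3/2)c)}^{R⁺((√3/2)c)} K(R)/(R·√(c² − K(R)²)) dR. (This is the analytic content of the existence and uniqueness of the Cisgeminate eye, the unique regular shrinker with two closed regions: both 4-cells have this energy c, and the change of angle of each outer curve equals h₁ + 4h₂ = π.) -/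
open Real

noncomputable def K (R : ℝ) : ℝ := Real.exp ((R ^ 2 - 1) / 2) / R

/-- `logKMinus b` is `log (K (exp (-b)))`. -/
noncomputable def logKMinus (b : ℝ) : ℝ := b - (1 - Real.exp (-2 * b)) / 2

/-- `logKPlus a` is `log (K (exp a))`. -/
noncomputable def logKPlus (a : ℝ) : ℝ := (Real.exp (2 * a) - 1) / 2 - a

/-- A function with nonnegative derivative takes a smaller value at the left endpoint. -/
lemma le_of_hasDerivAt_nonneg {f f' : ℝ → ℝ} {a b : ℝ} (hab : a ≤ b)
    (hf : ∀ x ∈ Set.Icc a b, HasDerivAt f (f' x) x) (hf' : ∀ x ∈ Set.Icc a b, 0 ≤ f' x) :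
    f a ≤ f b := by
  refine monotoneOn_of_deriv_nonneg (convex_Icc a b)
    (fun x hx => (hf x hx).continuousAt.continuousWithinAt) ?_ ?_
    (Set.left_mem_Icc.2 hab) (Set.right_mem_Icc.2 hab) hab
  · intro x hx
    exact (hf x (interior_subset hx)).differentiableAt.differentiableWithinAt
  · intro x hx
    rw [(hf x (interior_subset hx)).deriv]
    exact hf' x (interior_subset hx)

lemma hasDerivAt_exp_mul (r x : ℝ) :
    HasDerivAt (fun y => Real.exp (r * y)) (r * Real.exp (r * x)) x := by
  have := ((hasDerivAt_id x).const_mul r).exp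
  simpa [mul_comm] using this

lemma hasDerivAt_logKMinus (b : ℝ) : HasDerivAt logKMinus (1 - Real.exp (-2 * b)) b := by
  have := (hasDerivAt_id b).sub (((hasDerivAt_exp_mul (-2) b).const_sub 1).div_const 2)
  exact this.congr_deriv (by ring)

lemma hasDerivAt_logKPlus (a : ℝ) : HasDerivAt logKPlus (Real.exp (2 * a) - 1) a := by
  have := (((hasDerivAt_exp_mul 2 a).sub_const 1).div_const 2).sub (hasDerivAt_id a)
  exact this.congr_deriv (by ring)

lemma logKMinus_zero : logKMinus 0 = 0 := by simp [logKMinus]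

lemma logKPlus_zero : logKPlus 0 = 0 := by simp [logKPlus]

lemma logKMinus_strictMonoOn : StrictMonoOn logKMinus (Set.Ici 0) := by
  refine strictMonoOn_of_deriv_pos (convex_Ici 0)
    (fun x _ => (hasDerivAt_logKMinus x).continuousAt.continuousWithinAt) ?_
  intro x hx
  rw [interior_Ici] at hx
  rw [(hasDerivAt_logKMinus x).deriv, sub_pos, Real.exp_lt_one_iff]
  have : 0 < x := hx
  linarith

lemma logKPlus_strictMonoOn : StrictMonoOn logKPlus (Set.Ici 0) := by
  refine strictMonoOn_of_deriv_pos (convex_Ici 0)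
    (fun x _ => (hasDerivAt_logKPlus x).continuousAt.continuousWithinAt) ?_
  intro x hx
  rw [interior_Ici] at hx
  rw [(hasDerivAt_logKPlus x).deriv, sub_pos, Real.one_lt_exp_iff]
  have : 0 < x := hx
  linarith

lemma hasDerivAt_const_mul_sq (r x : ℝ) : HasDerivAt (fun y => r * y ^ 2) (2 * r * x) x := by
  have := (hasDerivAt_pow 2 x).const_mul r
  exact this.congr_deriv (by simp; ring)

lemma logKMinus_sub_le {b b' : ℝ} (h : b ≤ b') :
    logKMinus b' - logKMinus b ≤ b' ^ 2 - b ^ 2 := by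
  have := le_of_hasDerivAt_nonneg h
    (fun x _ => (hasDerivAt_const_mul_sq 1 x).sub (hasDerivAt_logKMinus x))
    (fun x _ => by linarith [Real.add_one_le_exp (-2 * x)])
  simp only [Pi.sub_apply] at this
  linarith

lemma le_logKMinus_sub {b b' : ℝ} (hb : 0 ≤ b) (h : b ≤ b') (hb' : b' ≤ 1 / 8) :
    3 / 4 * (b' ^ 2 - b ^ 2) ≤ logKMinus b' - logKMinus b := by
  have := le_of_hasDerivAt_nonneg h
    (fun x _ => (hasDerivAt_logKMinus x).sub (hasDerivAt_const_mul_sq (3 / 4) x))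
    (fun x hx => by
      have h1 := (abs_le.1 (Real.abs_exp_sub_one_sub_id_le (x := -2 * x)
        (abs_le.2 ⟨by linarith [hx.2], by linarith [hx.1]⟩))).2
      nlinarith [hx.1, hx.2])
  simp only [Pi.sub_apply] at this
  linarith

lemma le_logKPlus_sub {a a' : ℝ} (h : a ≤ a') :
    a' ^ 2 - a ^ 2 ≤ logKPlus a' - logKPlus a := by
  have := le_of_hasDerivAt_nonneg h
    (fun x _ => (hasDerivAt_logKPlus x).sub (hasDerivAt_const_mul_sq 1 x))
    (fun x _ => by linarith [Real.add_one_le_exp (2 * x)])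
  simp only [Pi.sub_apply] at this
  linarith

lemma logKPlus_sub_le {a a' : ℝ} (ha : 0 ≤ a) (h : a ≤ a') (ha' : a' ≤ 1 / 8) :
    logKPlus a' - logKPlus a ≤ 5 / 4 * (a' ^ 2 - a ^ 2) := by
  have := le_of_hasDerivAt_nonneg h
    (fun x _ => (hasDerivAt_const_mul_sq (5 / 4) x).sub (hasDerivAt_logKPlus x))
    (fun x hx => by
      have h1 := (abs_le.1 (Real.abs_exp_sub_one_sub_id_le (x := 2 * x)
        (abs_le.2 ⟨by linarith [hx.1], by linarith [hx.2]⟩))).2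
      nlinarith [hx.1, hx.2])
  simp only [Pi.sub_apply] at this
  linarith

lemma logKMinus_pos {b : ℝ} (hb : 0 < b) : 0 < logKMinus b := by
  have := logKMinus_strictMonoOn Set.self_mem_Ici hb.le hb
  rwa [logKMinus_zero] at this

lemma one_sub_exp_pos {b : ℝ} (hb : 0 < b) : 0 < 1 - Real.exp (-2 * b) := by
  rw [sub_pos, Real.exp_lt_one_iff]
  linarith

/-- The sharp comparison behind the monotonicity of `1 / (1 - R²) - 1 / (2 √(log K))`. -/
lemma four_mul_logKMinus_le {b : ℝ} (hb : 0 ≤ b) :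
    4 * logKMinus b ≤ ((1 - Real.exp (-2 * b)) * Real.exp (2 / 3 * b)) ^ 2 := by
  have hder := le_of_hasDerivAt_nonneg hb
    (fun x _ => (((hasDerivAt_exp_mul (4 / 3) x).sub ((hasDerivAt_exp_mul (-2 / 3) x).const_mul 2)).add
      (hasDerivAt_exp_mul (-8 / 3) x)).sub ((hasDerivAt_logKMinus x).const_mul 4))
    (fun x hx => by
      set z := Real.exp (-2 / 3 * x) with hz
      have hz0 : 0 < z := Real.exp_pos _
      have hz1 : z ≤ 1 := Real.exp_le_one_iff.2 (by linarith [hx.1])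
      have e1 : Real.exp (4 / 3 * x) = (z ^ 2)⁻¹ := by
        rw [hz, ← Real.exp_nat_mul, ← Real.exp_neg]; congr 1; push_cast; ring
      have e2 : Real.exp (-8 / 3 * x) = z ^ 4 := by
        rw [hz, ← Real.exp_nat_mul]; congr 1; push_cast; ring
      have e3 : Real.exp (-2 * x) = z ^ 3 := by
        rw [hz, ← Real.exp_nat_mul]; congr 1; push_cast; ring
      rw [e1, e2, e3]
      have key : 4 / 3 * (z ^ 2)⁻¹ - 2 * (-2 / 3 * z) + -8 / 3 * z ^ 4 - 4 * (1 - z ^ 3)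
          = 4 / 3 * ((1 - z) ^ 3 * (1 + 3 * z + 3 * z ^ 2 + 2 * z ^ 3)) * (z ^ 2)⁻¹ := by
        field_simp; ring
      rw [key]
      have : 0 ≤ 1 - z := by linarith
      positivity)
  simp only [Pi.sub_apply, Pi.add_apply, mul_zero, Real.exp_zero, logKMinus_zero] at hder
  have e1 : Real.exp (4 / 3 * b) = Real.exp (2 / 3 * b) ^ 2 := by
    rw [← Real.exp_nat_mul]; congr 1; push_cast; ring
  have e2 : Real.exp (-2 / 3 * b) = Real.exp (-2 * b) * Real.exp (2 / 3 * b) ^ 2 := by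
    rw [← e1, ← Real.exp_add]; congr 1; ring
  have e3 : Real.exp (-8 / 3 * b) = Real.exp (-2 * b) ^ 2 * Real.exp (2 / 3 * b) ^ 2 := by
    rw [← e1, ← Real.exp_nat_mul, ← Real.exp_add]; congr 1; push_cast; ring
  rw [e1, e2, e3] at hder
  linarith

lemma hasDerivAt_inv_sqrt_sub_inv {b : ℝ} (hb : 0 < b) :
    HasDerivAt (fun x => (2 * √(logKMinus x))⁻¹ - (1 - Real.exp (-2 * x))⁻¹)
      (2 * Real.exp (-2 * b) / (1 - Real.exp (-2 * b)) ^ 2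
        - (1 - Real.exp (-2 * b)) / (4 * √(logKMinus b) ^ 3)) b := by
  have hk := logKMinus_pos hb
  have hs := Real.sqrt_pos.2 hk
  have hy := one_sub_exp_pos hb
  have h1 := (((hasDerivAt_logKMinus b).sqrt hk.ne').const_mul 2).inv (by positivity)
  have h2 := ((hasDerivAt_exp_mul (-2) b).const_sub 1).inv hy.ne'
  refine (h1.sub h2).congr_deriv ?_
  field_simp
  ring

lemma inv_sub_inv_le {b b' : ℝ} (hb : 0 < b) (h : b ≤ b') :
    (1 - Real.exp (-2 * b))⁻¹ - (1 - Real.exp (-2 * b'))⁻¹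
      ≤ (2 * √(logKMinus b))⁻¹ - (2 * √(logKMinus b'))⁻¹ := by
  have hder := le_of_hasDerivAt_nonneg h
    (fun x hx => (hasDerivAt_inv_sqrt_sub_inv (hb.trans_le hx.1)).neg)
    (fun x hx => by
      have hx0 := hb.trans_le hx.1
      have hy := one_sub_exp_pos hx0
      have hs := Real.sqrt_pos.2 (logKMinus_pos hx0)
      have hE := Real.exp_pos (2 / 3 * x)
      have h1 : 2 * √(logKMinus x) ≤ (1 - Real.exp (-2 * x)) * Real.exp (2 / 3 * x) := by
        refine abs_le_of_sq_le_sq' ?_ (by positivity) |>.2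
        rw [mul_pow, Real.sq_sqrt (logKMinus_pos hx0).le]
        linarith [four_mul_logKMinus_le hx0.le]
      have h2 := pow_le_pow_left₀ (by positivity) h1 3
      have e1 : Real.exp (-2 * x) * Real.exp (2 / 3 * x) ^ 3 = 1 := by
        rw [← Real.exp_nat_mul, ← Real.exp_add, Real.exp_eq_one_iff]; push_cast; ring
      rw [neg_nonneg, sub_nonpos, div_le_div_iff₀ (by positivity) (by positivity)]
      have h3 := mul_le_mul_of_nonneg_left h2 (Real.exp_pos (-2 * x)).le
      have h4 : Real.exp (-2 * x) * ((1 - Real.exp (-2 * x)) * Real.exp (2 / 3 * x)) ^ 3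
          = (1 - Real.exp (-2 * x)) ^ 3 := by
        rw [mul_pow, mul_left_comm, e1, mul_one]
      rw [h4] at h3
      linarith)
  simp only [Pi.neg_apply] at hder
  linarith

lemma hasDerivAt_sq_div_sq {g y : ℝ} (h : 1 - g * y ≠ 0) :
    HasDerivAt (fun x => x ^ 2 / (1 - g * x) ^ 2) (2 * y / (1 - g * y) ^ 3) y := by
  have h1 := (hasDerivAt_pow 2 y).div ((((hasDerivAt_id y).const_mul g).const_sub 1).pow 2)
    (pow_ne_zero 2 h)
  refine h1.congr_deriv ?_
  simp
  field_simp
  ring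

lemma hasDerivAt_neg_two_mul_sub_log {y : ℝ} (h : y < 1) :
    HasDerivAt (fun x => -2 * x - 2 * Real.log (1 - x)) (2 * y / (1 - y)) y := by
  have h0 : 1 - y ≠ 0 := by linarith
  have h1 := ((hasDerivAt_id y).const_mul (-2)).sub
    ((((hasDerivAt_id y).const_sub 1).log h0).const_mul 2)
  refine h1.congr_deriv ?_
  simp
  field_simp
  ring

lemma four_mul_logKMinus_eq (b : ℝ) : 4 * logKMinus b =
    -2 * (1 - Real.exp (-2 * b)) - 2 * Real.log (1 - (1 - Real.exp (-2 * b))) := by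
  rw [sub_sub_cancel, Real.log_exp, logKMinus]; ring

lemma le_inv_one_sub_exp {b : ℝ} (hb : 0 < b) :
    (2 * √(logKMinus b))⁻¹ + 1 / 3 ≤ (1 - Real.exp (-2 * b))⁻¹ := by
  have hk := logKMinus_pos hb
  have hs := Real.sqrt_pos.2 hk
  have hE := Real.exp_pos (-2 * b)
  have hk4 := four_mul_logKMinus_eq b
  have hy := one_sub_exp_pos hb
  set y := 1 - Real.exp (-2 * b) with hydef
  have hy1 : y < 1 := by linarith
  have hder := le_of_hasDerivAt_nonneg hy.le
    (fun x hx => (hasDerivAt_neg_two_mul_sub_log (hx.2.trans_lt hy1)).sub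
      (hasDerivAt_sq_div_sq (g := 1 / 3) (y := x) (by linarith [hx.2])))
    (fun x hx => by
      have h0 := hx.1
      have h1 : 0 < 1 - x := by linarith [hx.2]
      have h2 : 0 < 1 - 1 / 3 * x := by linarith
      rw [sub_nonneg]
      refine div_le_div_of_nonneg_left (by linarith) h1 ?_
      nlinarith [mul_nonneg (sq_nonneg x) (show 0 ≤ 9 - x by linarith)])
  simp only [Pi.sub_apply] at hder
  have h3 : 0 < 1 - 1 / 3 * y := by linarith
  have h4 : (y / (1 - 1 / 3 * y)) ^ 2 ≤ (2 * √(logKMinus b)) ^ 2 := by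
    rw [mul_pow, Real.sq_sqrt hk.le, div_pow]
    norm_num at hder ⊢
    linarith
  have h5 := (abs_le_of_sq_le_sq' h4 (by positivity)).2
  have h6 := inv_anti₀ (by positivity) h5
  rw [inv_div, sub_div, mul_div_assoc, div_self hy.ne'] at h6
  rw [one_div] at h6
  linarith

lemma inv_one_sub_exp_le {b : ℝ} (hb : 0 < b) (hb1 : 1 / 4 ≤ Real.exp (-2 * b)) :
    (1 - Real.exp (-2 * b))⁻¹ ≤ (2 * √(logKMinus b))⁻¹ + 1 / 2 := by
  have hk := logKMinus_pos hb
  have hs := Real.sqrt_pos.2 hk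
  have hk4 := four_mul_logKMinus_eq b
  have hy := one_sub_exp_pos hb
  set y := 1 - Real.exp (-2 * b) with hydef
  have hy1 : y ≤ 3 / 4 := by linarith
  have hder := le_of_hasDerivAt_nonneg hy.le
    (fun x hx => (hasDerivAt_sq_div_sq (g := 1 / 2) (y := x) (by linarith [hx.2])).sub
      (hasDerivAt_neg_two_mul_sub_log (show x < 1 by linarith [hx.2])))
    (fun x hx => by
      have h0 := hx.1
      have h1 : 0 < 1 - x := by linarith [hx.2]
      have h2 : 0 < 1 - 1 / 2 * x := by linarith
      rw [sub_nonneg]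
      refine div_le_div_of_nonneg_left (by linarith) (by positivity) ?_
      have h7 : x ≤ 3 / 4 := hx.2.trans hy1
      nlinarith [mul_nonneg h0 (show 0 ≤ 1 / 2 - 3 / 4 * x + x ^ 2 / 8 by nlinarith)])
  simp only [Pi.sub_apply] at hder
  have h3 : 0 < 1 - 1 / 2 * y := by linarith
  have h4 : (2 * √(logKMinus b)) ^ 2 ≤ (y / (1 - 1 / 2 * y)) ^ 2 := by
    rw [mul_pow, Real.sq_sqrt hk.le, div_pow]
    norm_num at hder ⊢
    linarith
  have h5 := (abs_le_of_sq_le_sq' h4 (by positivity)).2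
  have h6 := inv_anti₀ (by positivity) h5
  rw [inv_div, sub_div, mul_div_assoc, div_self hy.ne', one_div] at h6
  linarith

/-- `r` inverts `k` on `[0, ∞)` and vanishes on `(-∞, 0]`. -/
structure IsBranch (k r : ℝ → ℝ) : Prop where
  eq_zero : ∀ u ≤ 0, r u = 0
  nonneg : ∀ u, 0 ≤ u → 0 ≤ r u
  apply_eq : ∀ u, 0 ≤ u → k (r u) = u

lemma IsBranch.monotone {k r : ℝ → ℝ} (h : IsBranch k r) (hk : StrictMonoOn k (Set.Ici 0)) :
    Monotone r := by
  intro x y hxy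
  rcases le_total x 0 with hx | hx
  · rw [h.eq_zero x hx]
    rcases le_total y 0 with hy | hy
    · rw [h.eq_zero y hy]
    · exact h.nonneg y hy
  · rw [← hk.le_iff_le (h.nonneg x hx) (h.nonneg y (hx.trans hxy)), h.apply_eq x hx,
      h.apply_eq y (hx.trans hxy)]
    exact hxy

lemma IsBranch.pos {k r : ℝ → ℝ} (h : IsBranch k r) (hk0 : k 0 = 0) {u : ℝ} (hu : 0 < u) :
    0 < r u := by
  refine (h.nonneg u hu.le).lt_of_ne fun h0 => ?_
  have := h.apply_eq u hu.le
  rw [← h0, hk0] at this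
  exact hu.ne this

/-- The logarithm of `sin ψ / sin (π / 3)`. -/
noncomputable def logSin (ψ : ℝ) : ℝ := Real.log (2 / √3 * Real.sin ψ)

/-- The rate of change of the polar angle along the inner branch. -/
noncomputable def angleRate (b : ℝ → ℝ) (ε ψ : ℝ) : ℝ :=
  (1 - Real.exp (-2 * b (ε + logSin ψ)))⁻¹

lemma log_two_div_sqrt_three : Real.log (2 / √3) = Real.log 2 - Real.log 3 / 2 := by
  rw [Real.log_div (by norm_num) (by positivity), Real.log_sqrt (by norm_num)]

lemma mul_sub_le_logSin {m p ψ : ℝ} (hp : π / 3 < p) (hp2 : p ≤ π / 2)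
    (hm : m * (p - π / 3) ≤ logSin p) (hψ : π / 3 ≤ ψ) (hψp : ψ ≤ p) :
    m * (ψ - π / 3) ≤ logSin ψ := by
  have hpi := Real.pi_pos
  have hd : 0 < p - π / 3 := by linarith
  set l := (ψ - π / 3) / (p - π / 3) with hl
  have hl0 : 0 ≤ l := div_nonneg (by linarith) hd.le
  have hl1 : l ≤ 1 := (div_le_one hd).2 (by linarith)
  have hld : l * (p - π / 3) = ψ - π / 3 := div_mul_cancel₀ _ hd.ne'
  have hlψ : (1 - l) * (π / 3) + l * p = ψ := by
    linear_combination hld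
  have hsin := strictConcaveOn_sin_Icc.concaveOn.2 (x := π / 3) (y := p)
    ⟨by linarith, by linarith⟩ ⟨by linarith, by linarith⟩ (sub_nonneg.2 hl1) hl0 (by ring)
  simp only [smul_eq_mul] at hsin
  rw [hlψ, Real.sin_pi_div_three] at hsin
  have hs3 : 0 < √3 := by positivity
  have hsp : 0 < Real.sin p := Real.sin_pos_of_pos_of_lt_pi (by linarith) (by linarith)
  set q := 2 / √3 * Real.sin p with hq
  have hq0 : 0 < q := by positivity
  have hlin : (1 - l) * 1 + l * q ≤ 2 / √3 * Real.sin ψ := by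
    have := mul_le_mul_of_nonneg_left hsin (show 0 ≤ 2 / √3 by positivity)
    refine le_trans (le_of_eq ?_) this
    rw [hq]; field_simp
  have hlog := strictConcaveOn_log_Ioi.concaveOn.2 (x := 1) (y := q)
    (Set.mem_Ioi.2 one_pos) hq0 (sub_nonneg.2 hl1) hl0 (by ring)
  simp only [smul_eq_mul, Real.log_one, mul_zero, zero_add] at hlog
  have hpos : 0 < (1 - l) * 1 + l * q := by
    rcases hl0.eq_or_lt with h | h
    · rw [← h]; norm_num
    · have := mul_pos h hq0
      linarith
  have h1 : l * Real.log q ≤ logSin ψ := hlog.trans (Real.log_le_log hpos hlin)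
  have h2 : m * (ψ - π / 3) = l * (m * (p - π / 3)) := by rw [← hld]; ring
  rw [h2]
  exact (mul_le_mul_of_nonneg_left hm hl0).trans h1

lemma logSin_pi_div_two : logSin (π / 2) = Real.log 2 - Real.log 3 / 2 := by
  rw [logSin, Real.sin_pi_div_two, mul_one, log_two_div_sqrt_three]

lemma quarter_mul_le_logSin {ψ : ℝ} (h : π / 3 ≤ ψ) (h' : ψ ≤ π / 2) :
    1 / 4 * (ψ - π / 3) ≤ logSin ψ := by
  have hpi := Real.pi_pos
  refine mul_sub_le_logSin (by linarith) le_rfl ?_ h h'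
  rw [logSin_pi_div_two]
  have := Real.pi_lt_d2
  have := Real.log_two_gt_d9
  have := Real.log_three_lt_d9
  linarith

lemma tenth_le_logSin : (1 / 10 : ℝ) ≤ logSin (5 * π / 12) := by
  have h1 : Real.sin (5 * π / 12) = √2 / 2 * (√3 / 2) + √2 / 2 * (1 / 2) := by
    rw [show 5 * π / 12 = π / 4 + π / 6 by ring, Real.sin_add, Real.sin_pi_div_four,
      Real.cos_pi_div_four, Real.sin_pi_div_six, Real.cos_pi_div_six]
  have h2 : 2 / √3 * (√2 / 2 * (√3 / 2) + √2 / 2 * (1 / 2)) = √2 / 2 * (1 + √3 / 3) := by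
    have h3 : √3 ^ 2 = 3 := Real.sq_sqrt (by norm_num)
    field_simp
    linear_combination -h3
  rw [logSin, h1, h2, Real.le_log_iff_exp_le (by positivity)]
  have h2 : (1.414 : ℝ) ≤ √2 := Real.le_sqrt_of_sq_le (by norm_num)
  have h3 : (1.732 : ℝ) ≤ √3 := Real.le_sqrt_of_sq_le (by norm_num)
  have h4 := (abs_le.1 (Real.abs_exp_sub_one_sub_id_le (x := 1 / 10) (by norm_num [abs_le]))).2
  nlinarith

lemma logSin_mono {ψ ψ' : ℝ} (h : π / 3 ≤ ψ) (h' : ψ ≤ ψ') (h2 : ψ' ≤ π / 2) :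
    logSin ψ ≤ logSin ψ' := by
  have hpi := Real.pi_pos
  have hs : 0 < Real.sin ψ := Real.sin_pos_of_pos_of_lt_pi (by linarith) (by linarith)
  have := Real.sin_le_sin_of_le_of_le_pi_div_two (by linarith) h2 h'
  exact Real.log_le_log (by positivity) (by gcongr)

lemma measurable_logSin : Measurable logSin :=
  Real.measurable_log.comp (Real.measurable_sin.const_mul _)

lemma measurable_angleRate {b : ℝ → ℝ} (hb : Monotone b) (ε : ℝ) : Measurable (angleRate b ε) := by
  have := hb.measurable.comp (measurable_logSin.const_add ε)
  exact ((this.const_mul (-2)).exp.const_sub 1).inv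

lemma hasDerivAt_mul_sqrt {e m s x : ℝ} (hm : m ≠ 0) (h : 0 < e + m * (x - s)) :
    HasDerivAt (fun y => m⁻¹ * √(e + m * (y - s))) (2 * √(e + m * (x - s)))⁻¹ x := by
  have h1 := (((((hasDerivAt_id x).sub_const s).const_mul m).const_add e).sqrt h.ne').const_mul m⁻¹
  refine h1.congr_deriv ?_
  have := Real.sqrt_pos.2 h
  simp
  field_simp

lemma inv_sqrt_sub_inv_sqrt_anti {x u η : ℝ} (hx : 0 < x) (hu : x ≤ u) (hη : 0 ≤ η) :
    (2 * √u)⁻¹ - (2 * √(u + η))⁻¹ ≤ (2 * √x)⁻¹ - (2 * √(x + η))⁻¹ := by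
  have aux : ∀ z : ℝ, 0 < z →
      (2 * √z)⁻¹ - (2 * √(z + η))⁻¹ = η / (2 * (√z * √(z + η) * (√z + √(z + η)))) := by
    intro z hz
    have h1 := Real.sqrt_pos.2 hz
    have h2 : 0 < √(z + η) := Real.sqrt_pos.2 (by linarith)
    have h3 := Real.sq_sqrt hz.le
    have h4 := Real.sq_sqrt (show 0 ≤ z + η by linarith)
    field_simp
    linear_combination h4 - h3
  rw [aux u (hx.trans_le hu), aux x hx]
  have h1 := Real.sqrt_pos.2 hx
  have h2 : 0 < √(x + η) := Real.sqrt_pos.2 (by linarith)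
  have h3 : √x ≤ √u := Real.sqrt_le_sqrt hu
  have h4 : √(x + η) ≤ √(u + η) := Real.sqrt_le_sqrt (by linarith)
  gcongr

/-- The graph of `1 / (2 √u)` lies above its tangent line at `u = 1 / 9`. -/
lemma tangent_le_inv_two_sqrt {u : ℝ} (hu : 0 < u) : 9 / 4 - 27 / 4 * u ≤ (2 * √u)⁻¹ := by
  have h := Real.sqrt_pos.2 hu
  have h2 := Real.sq_sqrt hu.le
  rw [← one_div, le_div_iff₀ (by positivity)]
  nlinarith [mul_nonneg (sq_nonneg (3 * √u - 1)) (show 0 ≤ 3 * √u + 2 by positivity)]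

lemma logSin_le {ψ : ℝ} (h : π / 3 ≤ ψ) (h' : ψ ≤ π / 2) :
    logSin ψ ≤ logSin (π / 2) - (π / 2 - ψ) ^ 2 / 2 := by
  have hpi := Real.pi_pos
  have hpos : ∀ x ∈ Set.Icc ψ (π / 2), 0 < Real.sin x := fun x hx =>
    Real.sin_pos_of_pos_of_lt_pi (by linarith [hx.1]) (by linarith [hx.2])
  have hder := le_of_hasDerivAt_nonneg h'
    (fun x hx => (((Real.hasDerivAt_sin x).const_mul (2 / √3)).log
      (by have := hpos x hx; positivity)).add
        ((((hasDerivAt_id x).const_sub (π / 2)).pow 2).div_const 2))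
    (fun x hx => by
      have hs := hpos x hx
      have h1 : Real.cos x = Real.sin (π / 2 - x) := (Real.sin_pi_div_two_sub x).symm
      have h2 : Real.sin x = Real.cos (π / 2 - x) := (Real.cos_pi_div_two_sub x).symm
      have h3 : π / 2 - x ≤ Real.tan (π / 2 - x) := by
        rcases (sub_nonneg.2 hx.2).eq_or_lt with h0 | h0
        · rw [← h0]; simp
        · exact (Real.lt_tan h0 (by linarith [hx.1])).le
      rw [Real.tan_eq_sin_div_cos, ← h1, ← h2] at h3
      rw [mul_div_mul_left _ _ (by positivity)]
      simp
      linarith)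
  simp at hder
  simp only [logSin, Real.sin_pi_div_two, mul_one]
  linarith

section

variable {b : ℝ → ℝ} (hb : IsBranch logKMinus b)
include hb

lemma angleRate_le {ε ψ : ℝ} (hε : 0 ≤ ε) (hε1 : ε ≤ 1 / 100) (h : π / 3 < ψ) (h' : ψ ≤ π / 2)
    {v : ℝ} (hv : 0 < v) (hv' : v ≤ logSin ψ) :
    angleRate b ε ψ ≤ (2 * √v)⁻¹ + 1 / 2 := by
  have hu : 0 < ε + logSin ψ := by linarith
  have hu1 : ε + logSin ψ ≤ logKMinus (Real.log 2) := by
    have h1 := logSin_mono h.le h' le_rfl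
    rw [logSin_pi_div_two] at h1
    have h2 : Real.exp (-2 * Real.log 2) = 1 / 4 := by
      rw [show -2 * Real.log 2 = -(Real.log 2 + Real.log 2) by ring, Real.exp_neg, Real.exp_add,
        Real.exp_log (by norm_num)]
      norm_num
    have := Real.log_three_gt_d9
    rw [logKMinus, h2]
    linarith
  have hb0 := hb.pos logKMinus_zero hu
  have hbl : b (ε + logSin ψ) ≤ Real.log 2 := by
    rwa [← logKMinus_strictMonoOn.le_iff_le hb0.le (Real.log_nonneg (by norm_num)),
      hb.apply_eq _ hu.le]
  have h3 : 1 / 4 ≤ Real.exp (-2 * b (ε + logSin ψ)) := by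
    rw [← Real.log_le_iff_le_exp (by norm_num), show (1 / 4 : ℝ) = (2 ^ 2)⁻¹ by norm_num,
      Real.log_inv, Real.log_pow]
    push_cast
    linarith
  have h4 := inv_one_sub_exp_le hb0 h3
  rw [hb.apply_eq _ hu.le] at h4
  have h5 : √v ≤ √(ε + logSin ψ) := Real.sqrt_le_sqrt (by linarith)
  have h6 := Real.sqrt_pos.2 hv
  have h7 : (2 * √(ε + logSin ψ))⁻¹ ≤ (2 * √v)⁻¹ := inv_anti₀ (by positivity) (by linarith)
  exact h4.trans (by linarith)

lemma angleRate_nonneg {ε ψ : ℝ} (hε : 0 ≤ ε) (h : π / 3 ≤ ψ) (h' : ψ ≤ π / 2) :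
    0 ≤ angleRate b ε ψ := by
  have h1 := quarter_mul_le_logSin h h'
  have h2 := hb.nonneg (ε + logSin ψ) (by linarith)
  rw [angleRate, inv_nonneg, sub_nonneg, Real.exp_le_one_iff]
  linarith

lemma intervalIntegrable_angleRate {ε : ℝ} (hε : 0 ≤ ε) (hε1 : ε ≤ 1 / 100) :
    IntervalIntegrable (angleRate b ε) MeasureTheory.volume (π / 3) (π / 2) := by
  have hpi := Real.pi_pos
  have hle : π / 3 ≤ π / 2 := by linarith
  have hdom : IntervalIntegrable (fun ψ => (2 * √(0 + 1 / 4 * (ψ - π / 3)))⁻¹ + 1 / 2)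
      MeasureTheory.volume (π / 3) (π / 2) := by
    refine IntervalIntegrable.add ?_ intervalIntegrable_const
    refine intervalIntegral.intervalIntegrable_deriv_of_nonneg
      (g := fun y => (1 / 4 : ℝ)⁻¹ * √(0 + 1 / 4 * (y - π / 3))) (by fun_prop) ?_ ?_
    · intro x hx
      rw [min_eq_left hle, max_eq_right hle] at hx
      exact hasDerivAt_mul_sqrt (by norm_num) (by linarith [hx.1])
    · intro x _
      positivity
  refine hdom.mono_fun (measurable_angleRate (hb.monotone logKMinus_strictMonoOn) ε).aestronglyMeasurable ?_
  refine (MeasureTheory.ae_restrict_iff' measurableSet_uIoc).2 (Filter.Eventually.of_forall ?_)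
  intro x hx
  rw [Set.uIoc_of_le hle] at hx
  dsimp only
  rw [Real.norm_of_nonneg (angleRate_nonneg hb hε hx.1.le hx.2), Real.norm_of_nonneg (by positivity)]
  refine angleRate_le hb hε hε1 hx.1 hx.2 (by linarith [hx.1]) ?_
  linarith [quarter_mul_le_logSin hx.1.le hx.2]

lemma integral_angleRate_anti {ε ε' : ℝ} (hε : 0 ≤ ε) (h : ε ≤ ε') (hε' : ε' ≤ 1 / 100) :
    ∫ ψ in (π / 3)..(π / 2), angleRate b ε' ψ ≤ ∫ ψ in (π / 3)..(π / 2), angleRate b ε ψ := by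
  have hpi := Real.pi_pos
  refine intervalIntegral.integral_mono_on_of_le_Ioo (by linarith)
    (intervalIntegrable_angleRate hb (hε.trans h) hε')
    (intervalIntegrable_angleRate hb hε (h.trans hε')) ?_
  intro x hx
  have h1 := quarter_mul_le_logSin hx.1.le hx.2.le
  have h2 := hb.pos logKMinus_zero (show 0 < ε + logSin x by linarith [hx.1])
  have h3 := hb.monotone logKMinus_strictMonoOn (show ε + logSin x ≤ ε' + logSin x by linarith)
  exact inv_anti₀ (one_sub_exp_pos h2)
    (sub_le_sub_left (Real.exp_le_exp.2 (by linarith)) _)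

lemma integral_angleRate_sub_le {ε ε' : ℝ} (hε : 0 ≤ ε) (h : ε ≤ ε') (hε' : ε' ≤ 1 / 100) :
    (∫ ψ in (π / 3)..(π / 2), angleRate b ε ψ) - ∫ ψ in (π / 3)..(π / 2), angleRate b ε' ψ
      ≤ 4 * (√ε' - √ε) := by
  have hpi := Real.pi_pos
  have hle : π / 3 ≤ π / 2 := by linarith
  have hi := intervalIntegrable_angleRate hb hε (h.trans hε')
  have hi' := intervalIntegrable_angleRate hb (hε.trans h) hε'
  rw [← intervalIntegral.integral_sub hi hi']
  have hm : (1 / 4 : ℝ) ≠ 0 := by norm_num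
  have key := intervalIntegral.integral_le_sub_of_hasDeriv_right_of_le hle
    (g := fun y => (1 / 4 : ℝ)⁻¹ * √(ε + 1 / 4 * (y - π / 3))
      - (1 / 4 : ℝ)⁻¹ * √(ε' + 1 / 4 * (y - π / 3)))
    (g' := fun x => (2 * √(ε + 1 / 4 * (x - π / 3)))⁻¹ - (2 * √(ε' + 1 / 4 * (x - π / 3)))⁻¹)
    (φ := fun ψ => angleRate b ε ψ - angleRate b ε' ψ) (by fun_prop)
    (fun x hx => ((hasDerivAt_mul_sqrt hm (by linarith [hx.1])).sub
      (hasDerivAt_mul_sqrt hm (by linarith [hx.1]))).hasDerivWithinAt)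
    ((intervalIntegrable_iff_integrableOn_Icc_of_le hle).1 (hi.sub hi'))
    (fun x hx => by
      have h1 := quarter_mul_le_logSin hx.1.le hx.2.le
      have hx0 := hx.1
      have hu : 0 < ε + logSin x := by linarith
      have hu' : 0 < ε' + logSin x := by linarith
      have h2 := hb.pos logKMinus_zero hu
      have h3 := hb.monotone logKMinus_strictMonoOn (show ε + logSin x ≤ ε' + logSin x by linarith)
      have h4 := inv_sub_inv_le h2 h3
      rw [hb.apply_eq _ hu.le, hb.apply_eq _ hu'.le] at h4
      refine h4.trans ?_
      have h5 := inv_sqrt_sub_inv_sqrt_anti (x := ε + 1 / 4 * (x - π / 3)) (u := ε + logSin x)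
        (η := ε' - ε) (by linarith) (by linarith) (by linarith)
      rwa [show ε + logSin x + (ε' - ε) = ε' + logSin x by ring,
        show ε + 1 / 4 * (x - π / 3) + (ε' - ε) = ε' + 1 / 4 * (x - π / 3) by ring] at h5)
  refine key.trans ?_
  have h6 : √(ε + 1 / 4 * (π / 2 - π / 3)) ≤ √(ε' + 1 / 4 * (π / 2 - π / 3)) :=
    Real.sqrt_le_sqrt (by linarith)
  simp only [sub_self, mul_zero, add_zero]
  norm_num at h6 ⊢
  linarith

lemma integral_angleRate_zero_lt : ∫ ψ in (π / 3)..(π / 2), angleRate b 0 ψ < π / 2 := by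
  have hpi := Real.pi_pos
  have hi := intervalIntegrable_angleRate hb le_rfl (by norm_num)
  have hi1 : IntervalIntegrable (angleRate b 0) MeasureTheory.volume (π / 3) (5 * π / 12) :=
    hi.mono_set (by
      rw [Set.uIcc_of_le (by linarith), Set.uIcc_of_le (by linarith)]
      exact Set.Icc_subset_Icc le_rfl (by linarith))
  have hi2 : IntervalIntegrable (angleRate b 0) MeasureTheory.volume (5 * π / 12) (π / 2) :=
    hi.mono_set (by
      rw [Set.uIcc_of_le (by linarith), Set.uIcc_of_le (by linarith)]
      exact Set.Icc_subset_Icc (by linarith) le_rfl)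
  rw [← intervalIntegral.integral_add_adjacent_intervals hi1 hi2]
  set m : ℝ := 6 / (5 * π) with hm
  have hm0 : 0 < m := by positivity
  have hmp : m * (5 * π / 12 - π / 3) = 1 / 10 := by rw [hm]; field_simp; norm_num
  have hsq : √(1 / 10 : ℝ) ^ 2 = 1 / 10 := Real.sq_sqrt (by norm_num)
  have hs0 : (0.316 : ℝ) ≤ √(1 / 10 : ℝ) := Real.le_sqrt_of_sq_le (by norm_num)
  have k1 := intervalIntegral.integral_le_sub_of_hasDeriv_right_of_le
    (show π / 3 ≤ 5 * π / 12 by linarith)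
    (g := fun y => m⁻¹ * √(0 + m * (y - π / 3)) + 1 / 2 * y)
    (g' := fun x => (2 * √(0 + m * (x - π / 3)))⁻¹ + 1 / 2 * 1)
    (φ := angleRate b 0) (by fun_prop)
    (fun x hx => ((hasDerivAt_mul_sqrt hm0.ne'
        (by rw [zero_add]; exact mul_pos hm0 (by linarith [hx.1]))).add
      ((hasDerivAt_id x).const_mul (1 / 2))).hasDerivWithinAt)
    ((intervalIntegrable_iff_integrableOn_Icc_of_le (by linarith)).1 hi1)
    (fun x hx => by
      rw [mul_one]
      refine angleRate_le hb le_rfl (by norm_num) hx.1 (by linarith [hx.2])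
        (by rw [zero_add]; exact mul_pos hm0 (by linarith [hx.1])) ?_
      rw [zero_add]
      exact mul_sub_le_logSin (by linarith) (by linarith) (hmp.trans_le tenth_le_logSin)
        hx.1.le hx.2.le)
  have k2 := intervalIntegral.integral_mono_on_of_le_Ioo (show 5 * π / 12 ≤ π / 2 by linarith)
    hi2 (g := fun _ => (2 * √(1 / 10 : ℝ))⁻¹ + 1 / 2) intervalIntegrable_const
    (fun x hx => angleRate_le hb le_rfl (by norm_num) (by linarith [hx.1]) hx.2.le
      (by norm_num) (tenth_le_logSin.trans (logSin_mono (by linarith) hx.1.le hx.2.le)))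
  rw [intervalIntegral.integral_const, smul_eq_mul] at k2
  simp only [sub_self, mul_zero, add_zero, Real.sqrt_zero, zero_add, hmp] at k1
  have hinv : (2 * √(1 / 10 : ℝ))⁻¹ = 5 * √(1 / 10 : ℝ) := by
    refine inv_eq_of_mul_eq_one_right ?_
    linear_combination 10 * hsq
  have hmi : m⁻¹ = 5 * π / 6 := by rw [hm, inv_div]
  rw [hinv] at k2
  rw [hmi] at k1
  have hs1 : √(1 / 10 : ℝ) ≤ 0.317 := Real.sqrt_le_iff.2 (by norm_num)
  nlinarith [mul_le_mul_of_nonneg_left hs1 hpi.le]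

lemma le_integral_angleRate {ε : ℝ} (hε : 0 ≤ ε) (hε1 : ε ≤ 1 / 100)
    (hε2 : ε + logSin (π / 2) = 0.15325) :
    0.972 ≤ ∫ ψ in (π / 3)..(π / 2), angleRate b ε ψ := by
  have hpi := Real.pi_pos
  have hle : π / 3 ≤ π / 2 := by linarith
  have key := intervalIntegral.sub_le_integral_of_hasDeriv_right_of_le hle
    (g := fun y => (31 / 12 - 27 / 4 * 0.15325) * y - 9 / 8 * (π / 2 - y) ^ 3)
    (g' := fun x => 31 / 12 - 27 / 4 * (0.15325 - (π / 2 - x) ^ 2 / 2))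
    (φ := angleRate b ε) (by fun_prop)
    (fun x _ => by
      have h1 := ((hasDerivAt_id x).const_mul (31 / 12 - 27 / 4 * 0.15325 : ℝ)).sub
        ((((hasDerivAt_id x).const_sub (π / 2)).pow 3).const_mul (9 / 8 : ℝ))
      refine (h1.congr_deriv ?_).hasDerivWithinAt
      simp
      ring)
    ((intervalIntegrable_iff_integrableOn_Icc_of_le hle).1
      (intervalIntegrable_angleRate hb hε hε1))
    (fun x hx => by
      have h1 := quarter_mul_le_logSin hx.1.le hx.2.le
      have hx0 := hx.1
      have hu : 0 < ε + logSin x := by linarith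
      have h2 := le_inv_one_sub_exp (hb.pos logKMinus_zero hu)
      rw [hb.apply_eq _ hu.le] at h2
      have h3 := logSin_le hx0.le hx.2.le
      have h4 := tangent_le_inv_two_sqrt hu
      refine le_trans ?_ h2
      linarith)
  refine le_trans ?_ key
  have h1 := Real.pi_gt_d4
  have h2 : (3.1415 : ℝ) ^ 3 ≤ π ^ 3 := pow_le_pow_left₀ (by norm_num) h1.le 3
  nlinarith

end

lemma mul_log_sub_log_le_integral {f : ℝ → ℝ} {C x y : ℝ} (hx : 0 < x) (hxy : x ≤ y)
    (hf : IntervalIntegrable f MeasureTheory.volume x y)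
    (h : ∀ R ∈ Set.Ioo x y, C / R ≤ f R) :
    C * (Real.log y - Real.log x) ≤ ∫ R in x..y, f R := by
  have key := intervalIntegral.sub_le_integral_of_hasDeriv_right_of_le hxy
    (g := fun R => C * Real.log R) (g' := fun R => C / R) (φ := f)
    (fun R hR => ((Real.continuousAt_log (hx.trans_le hR.1).ne').const_mul C).continuousWithinAt)
    (fun R hR => ((Real.hasDerivAt_log (hx.trans hR.1).ne').const_mul C).hasDerivWithinAt)
    ((intervalIntegrable_iff_integrableOn_Icc_of_le hxy).1 hf) h
  linarith

lemma integral_le_mul_log_sub_log {f : ℝ → ℝ} {C x y : ℝ} (hx : 0 < x) (hxy : x ≤ y)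
    (hf : IntervalIntegrable f MeasureTheory.volume x y)
    (h : ∀ R ∈ Set.Ioo x y, f R ≤ C / R) :
    ∫ R in x..y, f R ≤ C * (Real.log y - Real.log x) := by
  have key := mul_log_sub_log_le_integral (C := -C) hx hxy hf.neg
    (fun R hR => by simpa [neg_div] using h R hR)
  simp only [Pi.neg_apply, intervalIntegral.integral_neg] at key
  linarith

/-- The energy with excess `ε` over the minimal one. -/
noncomputable def energy (ε : ℝ) : ℝ := 2 / √3 * Real.exp ε

lemma energy_sq (ε : ℝ) : energy ε ^ 2 = 4 / 3 * Real.exp ε ^ 2 := by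
  rw [energy, mul_pow, div_pow, Real.sq_sqrt (by norm_num)]; norm_num

/-- The integrand giving the change of polar angle with respect to the radius. -/
noncomputable def radialRate (ε R : ℝ) : ℝ := K R / (R * √(energy ε ^ 2 - K R ^ 2))

lemma K_pos {R : ℝ} (hR : 0 < R) : 0 < K R := by rw [K]; positivity

lemma K_exp (l : ℝ) : K (Real.exp l) = Real.exp (logKPlus l) := by
  rw [K, ← Real.exp_sub, logKPlus, ← Real.exp_nat_mul]
  push_cast; rfl

lemma K_exp_neg (l : ℝ) : K (Real.exp (-l)) = Real.exp (logKMinus l) := by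
  rw [K_exp, logKPlus, logKMinus]; congr 1
  rw [show 2 * -l = -2 * l by ring]; ring

lemma one_le_K {R : ℝ} (hR : 0 < R) : 1 ≤ K R := by
  rw [← Real.exp_log hR, K_exp, Real.one_le_exp_iff, logKPlus]
  linarith [Real.add_one_le_exp (2 * Real.log R)]

lemma continuousOn_K : ContinuousOn K (Set.Ioi 0) := by
  unfold K
  exact ContinuousOn.div (by fun_prop) continuousOn_id fun x hx => ne_of_gt hx

lemma le_sqrt_energy {ε R : ℝ} (hR : 0 < R) (hK : K R ≤ Real.exp ε) :
    Real.exp ε / √3 ≤ √(energy ε ^ 2 - K R ^ 2) := by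
  refine Real.le_sqrt_of_sq_le ?_
  rw [div_pow, Real.sq_sqrt (by norm_num), energy_sq]
  nlinarith [pow_le_pow_left₀ (K_pos hR).le hK 2]

lemma sqrt_energy_pos {ε R : ℝ} (hR : 0 < R) (hK : K R ≤ Real.exp ε) :
    0 < √(energy ε ^ 2 - K R ^ 2) :=
  lt_of_lt_of_le (by positivity) (le_sqrt_energy hR hK)

lemma continuousOn_radialRate (ε : ℝ) {s : Set ℝ} (hs : ∀ R ∈ s, 0 < R ∧ K R ≤ Real.exp ε) :
    ContinuousOn (radialRate ε) s := by
  have hK : ContinuousOn K s := continuousOn_K.mono fun R hR => (hs R hR).1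
  refine hK.div (continuousOn_id.mul ((continuousOn_const.sub (hK.pow 2)).sqrt)) ?_
  intro R hR
  exact (mul_pos (hs R hR).1 (sqrt_energy_pos (hs R hR).1 (hs R hR).2)).ne'

lemma radialRate_eq (ε R : ℝ) :
    radialRate ε R = K R / √(energy ε ^ 2 - K R ^ 2) / R := by
  rw [radialRate, div_div, mul_comm R]

lemma radialRate_le {ε R : ℝ} (hR : 0 < R) (hK : K R ≤ Real.exp ε) : radialRate ε R ≤ 2 / R := by
  rw [radialRate_eq]
  refine div_le_div_of_nonneg_right ?_ hR.le
  rw [div_le_iff₀ (sqrt_energy_pos hR hK)]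
  have h1 := le_sqrt_energy hR hK
  have h2 : √3 ≤ 2 := Real.sqrt_le_iff.2 (by norm_num)
  have h3 : Real.exp ε / 2 ≤ Real.exp ε / √3 :=
    div_le_div_of_nonneg_left (Real.exp_pos ε).le (by positivity) h2
  linarith

lemma le_radialRate {ε R : ℝ} (hε : 0 ≤ ε) (hε1 : ε ≤ 1 / 100) (hR : 0 < R)
    (hK : K R ≤ Real.exp ε) : 1.66 / R ≤ radialRate ε R := by
  rw [radialRate_eq]
  refine div_le_div_of_nonneg_right ?_ hR.le
  rw [le_div_iff₀ (sqrt_energy_pos hR hK)]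
  have h1 := one_le_K hR
  have h2 := (abs_le.1 (Real.abs_exp_sub_one_sub_id_le (x := 2 * ε)
        (abs_le.2 ⟨by linarith, by linarith⟩))).2
  have h3 : Real.exp ε ^ 2 = Real.exp (2 * ε) := by rw [← Real.exp_nat_mul]; norm_num
  have h4 : √(energy ε ^ 2 - K R ^ 2) ≤ 1 / 1.66 := by
    rw [Real.sqrt_le_iff, energy_sq, h3]
    refine ⟨by norm_num, ?_⟩
    norm_num
    nlinarith
  linarith

lemma radialRate_anti {ε ε' R : ℝ} (h : ε ≤ ε') (hR : 0 < R) (hK : K R ≤ Real.exp ε) :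
    radialRate ε' R ≤ radialRate ε R := by
  have h1 := sqrt_energy_pos hR hK
  have h2 : √(energy ε ^ 2 - K R ^ 2) ≤ √(energy ε' ^ 2 - K R ^ 2) := by
    rw [energy_sq, energy_sq]; gcongr
  have := K_pos hR
  unfold radialRate
  gcongr

lemma radialRate_sub_le {ε ε' R : ℝ} (hε : 0 ≤ ε) (h : ε ≤ ε') (hε1 : ε' ≤ 1 / 100) (hR : 0 < R)
    (hK : K R ≤ Real.exp ε) :
    radialRate ε R - radialRate ε' R ≤ 7.1 * (ε' - ε) / R := by
  have hP := sqrt_energy_pos hR hK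
  have hPe := le_sqrt_energy hR hK
  have hk := K_pos hR
  have hE := Real.exp_pos ε
  have hPP : √(energy ε ^ 2 - K R ^ 2) ≤ √(energy ε' ^ 2 - K R ^ 2) := by
    rw [energy_sq, energy_sq]; gcongr
  have hsq := Real.sq_sqrt (Real.sqrt_pos.1 hP).le
  have hsq' := Real.sq_sqrt (Real.sqrt_pos.1 (hP.trans_le hPP)).le
  rw [radialRate_eq, radialRate_eq, ← sub_div]
  refine div_le_div_of_nonneg_right ?_ hR.le
  set P := √(energy ε ^ 2 - K R ^ 2)
  set Q := √(energy ε' ^ 2 - K R ^ 2)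
  set E := Real.exp ε
  have hQ : 0 < Q := hP.trans_le hPP
  have h2 := (abs_le.1 (Real.abs_exp_sub_one_sub_id_le (x := 2 * (ε' - ε))
        (abs_le.2 ⟨by linarith, by linarith⟩))).2
  have h3 : Real.exp ε' ^ 2 = E ^ 2 * Real.exp (2 * (ε' - ε)) := by
    rw [← Real.exp_nat_mul, ← Real.exp_nat_mul, ← Real.exp_add]; congr 1; push_cast; ring
  have h4 : Real.exp (2 * (ε' - ε)) - 1 ≤ 2.04 * (ε' - ε) := by nlinarith
  have e1 : K R / P - K R / Q = K R * (4 / 3 * E ^ 2 * (Real.exp (2 * (ε' - ε)) - 1))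
      / (P * Q * (P + Q)) := by
    have : Q ^ 2 - P ^ 2 = 4 / 3 * E ^ 2 * (Real.exp (2 * (ε' - ε)) - 1) := by
      rw [hsq, hsq', energy_sq, energy_sq, h3]; ring
    rw [← this]
    field_simp
    ring
  have hs3 : √3 ^ 2 = 3 := Real.sq_sqrt (by norm_num)
  have hs3' : √3 ≤ 1.7321 := Real.sqrt_le_iff.2 (by norm_num)
  have h5 : 2 * (E / √3) ^ 3 ≤ P * Q * (P + Q) := by
    have : (E / √3) ^ 3 ≤ P ^ 3 := pow_le_pow_left₀ (by positivity) hPe 3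
    have h6 : P * P * (P + P) ≤ P * Q * (P + Q) := by gcongr
    nlinarith
  have h0 : 0 ≤ Real.exp (2 * (ε' - ε)) - 1 := by
    rw [sub_nonneg, Real.one_le_exp_iff]; linarith
  rw [e1]
  calc K R * (4 / 3 * E ^ 2 * (Real.exp (2 * (ε' - ε)) - 1)) / (P * Q * (P + Q))
      ≤ E * (4 / 3 * E ^ 2 * (Real.exp (2 * (ε' - ε)) - 1)) / (2 * (E / √3) ^ 3) := by gcongr
    _ = 2 * √3 * (Real.exp (2 * (ε' - ε)) - 1) := by
        field_simp
        linear_combination (4 * (Real.exp (2 * (ε' - ε)) - 1)) * hs3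
    _ ≤ 2 * 1.7321 * (2.04 * (ε' - ε)) := by gcongr
    _ ≤ 7.1 * (ε' - ε) := by nlinarith

section

variable {a b : ℝ → ℝ} (ha : IsBranch logKPlus a) (hb : IsBranch logKMinus b)

/-- The change of polar angle along the arc whose radius runs over both branches. -/
noncomputable def radialAngle (a b : ℝ → ℝ) (ε : ℝ) : ℝ :=
  ∫ R in (Real.exp (-b ε))..(Real.exp (a ε)), radialRate ε R

include ha hb

lemma K_le_exp {ε R : ℝ} (hε : 0 ≤ ε) (h : Real.exp (-b ε) ≤ R) (h' : R ≤ Real.exp (a ε)) :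
    0 < R ∧ K R ≤ Real.exp ε := by
  have hR : 0 < R := (Real.exp_pos _).trans_le h
  refine ⟨hR, ?_⟩
  rw [← Real.le_log_iff_exp_le hR] at h
  rw [← Real.log_le_iff_le_exp hR] at h'
  rcases le_total 0 (Real.log R) with h0 | h0
  · rw [← Real.exp_log hR, K_exp, Real.exp_le_exp]
    have := logKPlus_strictMonoOn.monotoneOn h0 (ha.nonneg ε hε) h'
    rwa [ha.apply_eq ε hε] at this
  · rw [← Real.exp_log hR, ← neg_neg (Real.log R), K_exp_neg, Real.exp_le_exp]
    have := logKMinus_strictMonoOn.monotoneOn (neg_nonneg.2 h0) (hb.nonneg ε hε)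
      (by linarith : -Real.log R ≤ b ε)
    rwa [hb.apply_eq ε hε] at this

lemma intervalIntegrable_radialRate {ε x y : ℝ} (hε : 0 ≤ ε) (hxy : x ≤ y)
    (hx : Real.exp (-b ε) ≤ x) (hy : y ≤ Real.exp (a ε)) :
    IntervalIntegrable (radialRate ε) MeasureTheory.volume x y := by
  refine (continuousOn_radialRate ε ?_).intervalIntegrable
  intro R hR
  rw [Set.uIcc_of_le hxy] at hR
  exact K_le_exp ha hb hε (hx.trans hR.1) (hR.2.trans hy)

lemma exp_neg_le_exp {ε : ℝ} (hε : 0 ≤ ε) : Real.exp (-b ε) ≤ Real.exp (a ε) :=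
  Real.exp_le_exp.2 (by linarith [ha.nonneg ε hε, hb.nonneg ε hε])

lemma mul_le_radialAngle {ε : ℝ} (hε : 0 ≤ ε) (hε1 : ε ≤ 1 / 100) :
    1.66 * (a ε + b ε) ≤ radialAngle a b ε := by
  have hle := exp_neg_le_exp ha hb hε
  have := mul_log_sub_log_le_integral (Real.exp_pos _) hle
    (intervalIntegrable_radialRate ha hb hε hle le_rfl le_rfl) (C := 1.66)
    (fun R hR => by
      obtain ⟨h1, h2⟩ := K_le_exp ha hb hε hR.1.le hR.2.le
      exact le_radialRate hε hε1 h1 h2)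
  rwa [Real.log_exp, Real.log_exp, sub_neg_eq_add] at this

lemma radialAngle_sub_eq {ε ε' : ℝ} (hε : 0 ≤ ε) (h : ε ≤ ε') :
    radialAngle a b ε' - radialAngle a b ε =
      (∫ R in (Real.exp (-b ε'))..(Real.exp (-b ε)), radialRate ε' R) +
      (∫ R in (Real.exp (a ε))..(Real.exp (a ε')), radialRate ε' R) -
      ∫ R in (Real.exp (-b ε))..(Real.exp (a ε)), (radialRate ε R - radialRate ε' R) := by
  have hε' := hε.trans h
  have hle := exp_neg_le_exp ha hb hε
  have ha' := Real.exp_le_exp.2 (ha.monotone logKPlus_strictMonoOn h)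
  have hb' := Real.exp_le_exp.2 (neg_le_neg (hb.monotone logKMinus_strictMonoOn h))
  have i1 := intervalIntegrable_radialRate ha hb hε' hb' le_rfl (hle.trans ha')
  have i2 := intervalIntegrable_radialRate ha hb hε' hle hb' ha'
  have i3 := intervalIntegrable_radialRate ha hb hε' ha' (hb'.trans hle) le_rfl
  rw [intervalIntegral.integral_sub (intervalIntegrable_radialRate ha hb hε hle le_rfl le_rfl) i2,
    radialAngle, radialAngle,
    ← intervalIntegral.integral_add_adjacent_intervals (i1.trans i2) i3,
    ← intervalIntegral.integral_add_adjacent_intervals i1 i2]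
  ring

lemma le_radialAngle_sub {ε ε' : ℝ} (hε : 0 ≤ ε) (h : ε ≤ ε') (hε1 : ε' ≤ 1 / 100) :
    1.66 * (a ε' - a ε + (b ε' - b ε)) - 7.1 * (ε' - ε) * (a ε + b ε)
      ≤ radialAngle a b ε' - radialAngle a b ε := by
  have hε' := hε.trans h
  have hle := exp_neg_le_exp ha hb hε
  have ha' := Real.exp_le_exp.2 (ha.monotone logKPlus_strictMonoOn h)
  have hb' := Real.exp_le_exp.2 (neg_le_neg (hb.monotone logKMinus_strictMonoOn h))
  have hrate : ∀ R, Real.exp (-b ε') ≤ R → R ≤ Real.exp (a ε') → 1.66 / R ≤ radialRate ε' R :=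
    fun R h1 h2 => by
      obtain ⟨h3, h4⟩ := K_le_exp ha hb hε' h1 h2
      exact le_radialRate hε' hε1 h3 h4
  have k1 := mul_log_sub_log_le_integral (Real.exp_pos _) hb'
    (intervalIntegrable_radialRate ha hb hε' hb' le_rfl (hle.trans ha'))
    (fun R hR => hrate R hR.1.le (hR.2.le.trans (hle.trans ha')))
  have k2 := mul_log_sub_log_le_integral (Real.exp_pos _) ha'
    (intervalIntegrable_radialRate ha hb hε' ha' (hb'.trans hle) le_rfl)
    (fun R hR => hrate R ((hb'.trans hle).trans hR.1.le) hR.2.le)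
  have k3 := integral_le_mul_log_sub_log (Real.exp_pos _) hle
    ((intervalIntegrable_radialRate ha hb hε hle le_rfl le_rfl).sub
      (intervalIntegrable_radialRate ha hb hε' hle hb' ha'))
    (fun R hR => by
      obtain ⟨h3, h4⟩ := K_le_exp ha hb hε hR.1.le hR.2.le
      exact radialRate_sub_le hε h hε1 h3 h4)
  simp only [Real.log_exp] at k1 k2 k3
  rw [radialAngle_sub_eq ha hb hε h]
  linarith

lemma radialAngle_sub_le {ε ε' : ℝ} (hε : 0 ≤ ε) (h : ε ≤ ε') :
    radialAngle a b ε' - radialAngle a b ε ≤ 2 * (a ε' - a ε + (b ε' - b ε)) := by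
  have hε' := hε.trans h
  have hle := exp_neg_le_exp ha hb hε
  have ha' := Real.exp_le_exp.2 (ha.monotone logKPlus_strictMonoOn h)
  have hb' := Real.exp_le_exp.2 (neg_le_neg (hb.monotone logKMinus_strictMonoOn h))
  have hrate : ∀ R, Real.exp (-b ε') ≤ R → R ≤ Real.exp (a ε') → radialRate ε' R ≤ 2 / R :=
    fun R h1 h2 => by
      obtain ⟨h3, h4⟩ := K_le_exp ha hb hε' h1 h2
      exact radialRate_le h3 h4
  have k1 := integral_le_mul_log_sub_log (Real.exp_pos _) hb'
    (intervalIntegrable_radialRate ha hb hε' hb' le_rfl (hle.trans ha'))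
    (fun R hR => hrate R hR.1.le (hR.2.le.trans (hle.trans ha')))
  have k2 := integral_le_mul_log_sub_log (Real.exp_pos _) ha'
    (intervalIntegrable_radialRate ha hb hε' ha' (hb'.trans hle) le_rfl)
    (fun R hR => hrate R ((hb'.trans hle).trans hR.1.le) hR.2.le)
  have k3 : 0 ≤ ∫ R in (Real.exp (-b ε))..(Real.exp (a ε)), (radialRate ε R - radialRate ε' R) := by
    refine intervalIntegral.integral_nonneg hle fun R hR => ?_
    obtain ⟨h3, h4⟩ := K_le_exp ha hb hε hR.1 hR.2
    exact sub_nonneg.2 (radialRate_anti h h3 h4)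
  simp only [Real.log_exp] at k1 k2
  rw [radialAngle_sub_eq ha hb hε h]
  linarith

end

/-- The energy excess of the upper endpoint of the energy interval. -/
noncomputable def maxExcess : ℝ := 0.15325 - Real.log (2 / √3)

lemma maxExcess_bounds : 0.0094 ≤ maxExcess ∧ maxExcess ≤ 1 / 100 := by
  rw [maxExcess, log_two_div_sqrt_three]
  have := Real.log_two_gt_d9
  have := Real.log_two_lt_d9
  have := Real.log_three_gt_d9
  have := Real.log_three_lt_d9
  constructor <;> linarith

section

variable {a b : ℝ → ℝ} (ha : IsBranch logKPlus a) (hb : IsBranch logKMinus b)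

/-- The total change of polar angle, using the symmetry of the inner arc. -/
noncomputable def totalAngle (a b : ℝ → ℝ) (ε : ℝ) : ℝ :=
  2 * (∫ ψ in (π / 3)..(π / 2), angleRate b ε ψ) + 4 * radialAngle a b ε

include ha in
lemma plus_bounds {ε : ℝ} (hε : 0 ≤ ε) (hε1 : ε ≤ 1 / 100) : a ε ≤ 1 / 8 ∧ a ε ≤ √ε := by
  have h0 := ha.nonneg ε hε
  have h1 := le_logKPlus_sub h0
  rw [logKPlus_zero, ha.apply_eq ε hε] at h1
  refine ⟨?_, Real.le_sqrt_of_sq_le (by linarith)⟩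
  nlinarith

include hb in
lemma minus_bounds {ε : ℝ} (hε : 0 ≤ ε) (hε1 : ε ≤ 1 / 100) :
    b ε ≤ 1 / 8 ∧ b ε ≤ 1.16 * √ε := by
  have h0 := hb.nonneg ε hε
  have h8 : b ε ≤ 1 / 8 := by
    by_contra! h
    have h1 := logKMinus_strictMonoOn.monotoneOn
      (Set.mem_Ici.2 (by norm_num : (0 : ℝ) ≤ 1 / 8)) h0 h.le
    rw [hb.apply_eq ε hε] at h1
    have h2 := le_logKMinus_sub le_rfl (by norm_num : (0 : ℝ) ≤ 1 / 8) le_rfl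
    rw [logKMinus_zero] at h2
    norm_num at h2
    linarith
  refine ⟨h8, ?_⟩
  have h1 := le_logKMinus_sub le_rfl h0 h8
  rw [logKMinus_zero, hb.apply_eq ε hε] at h1
  refine abs_le_of_sq_le_sq' ?_ (by positivity) |>.2
  rw [mul_pow, Real.sq_sqrt hε]
  linarith

include ha in
lemma le_plus_sub {ε ε' : ℝ} (hε : 0 ≤ ε) (h : ε ≤ ε') (hε1 : ε' ≤ 1 / 100) :
    0.8 * (√ε' - √ε) ≤ a ε' - a ε := by
  have hε' := hε.trans h
  have hm := ha.monotone logKPlus_strictMonoOn h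
  have h0 := ha.nonneg ε hε
  obtain ⟨-, hs⟩ := plus_bounds ha hε (h.trans hε1)
  obtain ⟨h8, hs'⟩ := plus_bounds ha hε' hε1
  have h1 := logKPlus_sub_le h0 hm h8
  rw [ha.apply_eq ε hε, ha.apply_eq ε' hε'] at h1
  have hst : √ε ≤ √ε' := Real.sqrt_le_sqrt h
  have e1 := Real.sq_sqrt hε
  have e2 := Real.sq_sqrt hε'
  have hsn := Real.sqrt_nonneg ε
  rcases (hsn.trans hst).eq_or_lt with h2 | h2
  · linarith
  · by_contra! hc
    nlinarith

include hb in
lemma le_minus_sub {ε ε' : ℝ} (hε : 0 ≤ ε) (h : ε ≤ ε') (hε1 : ε' ≤ 1 / 100) :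
    0.86 * (√ε' - √ε) ≤ b ε' - b ε := by
  have hε' := hε.trans h
  have hm := hb.monotone logKMinus_strictMonoOn h
  have h0 := hb.nonneg ε hε
  obtain ⟨-, hs⟩ := minus_bounds hb hε (h.trans hε1)
  obtain ⟨-, hs'⟩ := minus_bounds hb hε' hε1
  have h1 := logKMinus_sub_le hm
  rw [hb.apply_eq ε hε, hb.apply_eq ε' hε'] at h1
  have hst : √ε ≤ √ε' := Real.sqrt_le_sqrt h
  have e1 := Real.sq_sqrt hε
  have e2 := Real.sq_sqrt hε'
  have hsn := Real.sqrt_nonneg ε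
  rcases (hsn.trans hst).eq_or_lt with h2 | h2
  · linarith
  · by_contra! hc
    nlinarith

include ha in
lemma plus_sub_le {ε ε' : ℝ} (hε : 0 ≤ ε) (h : ε ≤ ε') : a ε' - a ε ≤ √(ε' - ε) := by
  have hm := ha.monotone logKPlus_strictMonoOn h
  have h0 := ha.nonneg ε hε
  have h1 := le_logKPlus_sub hm
  rw [ha.apply_eq ε hε, ha.apply_eq ε' (hε.trans h)] at h1
  refine Real.le_sqrt_of_sq_le ?_
  nlinarith

include hb in
lemma minus_sub_le {ε ε' : ℝ} (hε : 0 ≤ ε) (h : ε ≤ ε') (hε1 : ε' ≤ 1 / 100) :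
    b ε' - b ε ≤ 2 * √(ε' - ε) := by
  have hm := hb.monotone logKMinus_strictMonoOn h
  have h0 := hb.nonneg ε hε
  have h1 := le_logKMinus_sub h0 hm (minus_bounds hb (hε.trans h) hε1).1
  rw [hb.apply_eq ε hε, hb.apply_eq ε' (hε.trans h)] at h1
  refine abs_le_of_sq_le_sq' ?_ (by positivity) |>.2
  rw [mul_pow, Real.sq_sqrt (by linarith)]
  nlinarith

include ha hb

lemma le_totalAngle_sub {ε ε' : ℝ} (hε : 0 ≤ ε) (h : ε ≤ ε') (hε1 : ε' ≤ 1 / 100) :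
    √ε' - √ε ≤ totalAngle a b ε' - totalAngle a b ε := by
  have h1 := integral_angleRate_sub_le hb hε h hε1
  have h2 := le_radialAngle_sub ha hb hε h hε1
  have h3 := le_plus_sub ha hε h hε1
  have h4 := le_minus_sub hb hε h hε1
  have h5 := (plus_bounds ha hε (h.trans hε1)).1
  have h6 := (minus_bounds hb hε (h.trans hε1)).1
  have hst : √ε ≤ √ε' := Real.sqrt_le_sqrt h
  have hs1 : √ε' ≤ 0.1 := Real.sqrt_le_iff.2 ⟨by norm_num, by norm_num; linarith⟩
  have h7 : ε' - ε ≤ 0.2 * (√ε' - √ε) := by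
    nlinarith [Real.sq_sqrt hε, Real.sq_sqrt (hε.trans h)]
  have h8 : 7.1 * (ε' - ε) * (a ε + b ε) ≤ 7.1 * (0.2 * (√ε' - √ε)) * (1 / 4) := by
    have := ha.nonneg ε hε
    have := hb.nonneg ε hε
    gcongr
    linarith
  unfold totalAngle
  linarith

lemma totalAngle_sub_le {ε ε' : ℝ} (hε : 0 ≤ ε) (h : ε ≤ ε') (hε1 : ε' ≤ 1 / 100) :
    totalAngle a b ε' - totalAngle a b ε ≤ 24 * √(ε' - ε) := by
  have h1 := integral_angleRate_anti hb hε h hε1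
  have h2 := radialAngle_sub_le ha hb hε h
  have h3 := plus_sub_le ha hε h
  have h4 := minus_sub_le hb hε h hε1
  unfold totalAngle
  linarith

lemma totalAngle_strictMonoOn : StrictMonoOn (totalAngle a b) (Set.Icc 0 maxExcess) := by
  intro x hx y hy hxy
  have h1 := le_totalAngle_sub ha hb hx.1 hxy.le (hy.2.trans maxExcess_bounds.2)
  have h2 := Real.sqrt_lt_sqrt hx.1 hxy
  linarith

lemma totalAngle_continuousOn : ContinuousOn (totalAngle a b) (Set.Icc 0 maxExcess) := by
  have key : ∀ x ∈ Set.Icc 0 maxExcess, ∀ y ∈ Set.Icc 0 maxExcess, x ≤ y →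
      |totalAngle a b y - totalAngle a b x| ≤ 24 * √|y - x| := by
    intro x hx y hy hxy
    have hm := (totalAngle_strictMonoOn ha hb).monotoneOn hx hy hxy
    rw [abs_of_nonneg (sub_nonneg.2 hm), abs_of_nonneg (sub_nonneg.2 hxy)]
    exact totalAngle_sub_le ha hb hx.1 hxy (hy.2.trans maxExcess_bounds.2)
  intro x hx
  rw [ContinuousWithinAt, tendsto_iff_dist_tendsto_zero]
  have hlim : Filter.Tendsto (fun y => 24 * √|y - x|) (nhdsWithin x (Set.Icc 0 maxExcess))
      (nhds 0) := by
    have : Continuous fun y : ℝ => 24 * √|y - x| := by fun_prop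
    simpa using (this.tendsto x).mono_left nhdsWithin_le_nhds
  refine squeeze_zero' (Filter.Eventually.of_forall fun _ => dist_nonneg) ?_ hlim
  filter_upwards [self_mem_nhdsWithin] with y hy
  rw [Real.dist_eq]
  rcases le_total x y with h | h
  · exact key x hx y hy h
  · rw [abs_sub_comm, abs_sub_comm y]
    exact key y hy x hx h

lemma totalAngle_zero_lt : totalAngle a b 0 < π := by
  have h1 := integral_angleRate_zero_lt hb
  have h2 : radialAngle a b 0 = 0 := by
    rw [radialAngle, ha.eq_zero 0 le_rfl, hb.eq_zero 0 le_rfl]; simp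
  rw [totalAngle, h2]
  linarith

lemma lt_totalAngle_maxExcess : π < totalAngle a b maxExcess := by
  obtain ⟨hl, hu⟩ := maxExcess_bounds
  have h0 : 0 ≤ maxExcess := by linarith
  have h1 := le_integral_angleRate hb h0 hu
    (by rw [logSin_pi_div_two, maxExcess, log_two_div_sqrt_three]; ring)
  have h2 := mul_le_radialAngle ha hb h0 hu
  have h3 : 0.09 ≤ a maxExcess := by
    by_contra! h
    have h4 := logKPlus_sub_le (ha.nonneg _ h0) h.le (by norm_num)
    have h5 := logKPlus_strictMonoOn (ha.nonneg _ h0) (Set.mem_Ici.2 (by norm_num)) h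
    rw [ha.apply_eq _ h0, logKPlus] at h5
    have h6 := Real.exp_bound' (x := 2 * 0.09) (by norm_num) (by norm_num) (n := 4) (by norm_num)
    norm_num [Finset.sum_range_succ, Nat.factorial] at h5 h6
    linarith
  have h4 : 0.095 ≤ b maxExcess := by
    have h5 := logKMinus_sub_le (hb.nonneg _ h0)
    rw [logKMinus_zero, hb.apply_eq _ h0] at h5
    have := hb.nonneg _ h0
    nlinarith
  have := Real.pi_lt_d2
  unfold totalAngle
  linarith

lemma existsUnique_totalAngle_eq_pi : ∃! ε, ε ∈ Set.Icc 0 maxExcess ∧ totalAngle a b ε = π := by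
  have h0 : 0 ≤ maxExcess := by linarith [maxExcess_bounds.1]
  obtain ⟨ε, hε, h⟩ := intermediate_value_Icc h0 (totalAngle_continuousOn ha hb)
    ⟨(totalAngle_zero_lt ha hb).le, (lt_totalAngle_maxExcess ha hb).le⟩
  refine ⟨ε, ⟨hε, h⟩, fun y hy => ?_⟩
  exact (totalAngle_strictMonoOn ha hb).injOn hy.1 hε (hy.2.trans h.symm)

end

lemma logSin_pi_sub (ψ : ℝ) : logSin (π - ψ) = logSin ψ := by
  rw [logSin, logSin, Real.sin_pi_sub]

lemma integral_angleRate_eq {b : ℝ → ℝ} (hb : IsBranch logKMinus b) {ε : ℝ} (hε : 0 ≤ ε)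
    (hε1 : ε ≤ 1 / 100) : ∫ ψ in (π / 3)..(2 * π / 3), angleRate b ε ψ =
      2 * ∫ ψ in (π / 3)..(π / 2), angleRate b ε ψ := by
  have i1 := intervalIntegrable_angleRate hb hε hε1
  have hsymm : (fun ψ => angleRate b ε (π - ψ)) = angleRate b ε := by
    funext ψ; rw [angleRate, angleRate, logSin_pi_sub]
  have i2 := (i1.comp_sub_left π).symm
  rw [hsymm, show π - π / 2 = π / 2 by ring, show π - π / 3 = 2 * π / 3 by ring] at i2
  have e := intervalIntegral.integral_comp_sub_left (a := π / 2) (b := 2 * π / 3)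
    (angleRate b ε) π
  rw [hsymm, show π - π / 2 = π / 2 by ring, show π - 2 * π / 3 = π / 3 by ring] at e
  rw [← intervalIntegral.integral_add_adjacent_intervals i1 i2, e]
  ring

lemma logSin_nonneg {ψ : ℝ} (h : π / 3 ≤ ψ) (h' : ψ ≤ 2 * π / 3) : 0 ≤ logSin ψ := by
  rcases le_total ψ (π / 2) with h1 | h1
  · linarith [quarter_mul_le_logSin h h1]
  · have h2 := quarter_mul_le_logSin (ψ := π - ψ) (by linarith) (by linarith)
    rw [logSin_pi_sub] at h2
    linarith

lemma energy_mul_sin {ε ψ : ℝ} (h : π / 3 ≤ ψ) (h' : ψ ≤ 2 * π / 3) :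
    energy ε * Real.sin ψ = Real.exp (ε + logSin ψ) := by
  have hpi := Real.pi_pos
  have hs : 0 < Real.sin ψ := Real.sin_pos_of_pos_of_lt_pi (by linarith) (by linarith)
  rw [Real.exp_add, logSin, Real.exp_log (by positivity), energy]
  ring

lemma sqrt_three_div_two_mul_energy (ε : ℝ) : √3 / 2 * energy ε = Real.exp ε := by
  rw [energy]; field_simp

theorem stmt_15 (Rm Rp : ℝ → ℝ)
    (hRm : ∀ x : ℝ, 1 < x → 0 < Rm x ∧ Rm x < 1 ∧ K (Rm x) = x)
    (hRp : ∀ x : ℝ, 1 < x → 1 < Rp x ∧ K (Rp x) = x)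
    (hRm1 : Rm 1 = 1) (hRp1 : Rp 1 = 1) :
    ∃! c : ℝ, c ∈ Set.Icc (2 / Real.sqrt 3) (Real.exp 0.15325) ∧
      (∫ ψ in (π / 3)..(2 * π / 3), (1 - (Rm (c * Real.sin ψ)) ^ 2)⁻¹) +
        4 * (∫ R in (Rm (Real.sqrt 3 / 2 * c))..(Rp (Real.sqrt 3 / 2 * c)),
          K R / (R * Real.sqrt (c ^ 2 - (K R) ^ 2))) = π := by
  set a : ℝ → ℝ := fun u => if u ≤ 0 then 0 else Real.log (Rp (Real.exp u)) with ha_def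
  set b : ℝ → ℝ := fun u => if u ≤ 0 then 0 else -Real.log (Rm (Real.exp u)) with hb_def
  have hpa : ∀ u, 0 ≤ u → 0 ≤ a u ∧ Real.exp (a u) = Rp (Real.exp u) ∧ logKPlus (a u) = u := by
    intro u hu
    rcases hu.eq_or_lt with rfl | hu
    · simp [ha_def, hRp1, logKPlus_zero]
    · obtain ⟨h1, h2⟩ := hRp (Real.exp u) (Real.one_lt_exp_iff.2 hu)
      have e : Real.exp (a u) = Rp (Real.exp u) := by
        simp only [ha_def, not_le.2 hu, if_false]
        exact Real.exp_log (by linarith)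
      refine ⟨?_, e, ?_⟩
      · rw [← Real.one_le_exp_iff, e]; exact h1.le
      · rw [← Real.exp_eq_exp, ← K_exp, e, h2]
  have hpb : ∀ u, 0 ≤ u → 0 ≤ b u ∧ Real.exp (-b u) = Rm (Real.exp u) ∧ logKMinus (b u) = u := by
    intro u hu
    rcases hu.eq_or_lt with rfl | hu
    · simp [hb_def, hRm1, logKMinus_zero]
    · obtain ⟨h0, h1, h2⟩ := hRm (Real.exp u) (Real.one_lt_exp_iff.2 hu)
      have e : Real.exp (-b u) = Rm (Real.exp u) := by
        simp only [hb_def, not_le.2 hu, if_false, neg_neg]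
        exact Real.exp_log h0
      refine ⟨?_, e, ?_⟩
      · rw [← neg_nonpos, ← Real.exp_le_one_iff, e]; exact h1.le
      · rw [← Real.exp_eq_exp, ← K_exp_neg, e, h2]
  have ha : IsBranch logKPlus a :=
    ⟨fun u hu => if_pos hu, fun u hu => (hpa u hu).1, fun u hu => (hpa u hu).2.2⟩
  have hb : IsBranch logKMinus b :=
    ⟨fun u hu => if_pos hu, fun u hu => (hpb u hu).1, fun u hu => (hpb u hu).2.2⟩
  have htotal : ∀ ε ∈ Set.Icc 0 maxExcess,
      (∫ ψ in (π / 3)..(2 * π / 3), (1 - (Rm (energy ε * Real.sin ψ)) ^ 2)⁻¹) +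
        4 * (∫ R in (Rm (√3 / 2 * energy ε))..(Rp (√3 / 2 * energy ε)),
          K R / (R * √(energy ε ^ 2 - (K R) ^ 2))) = totalAngle a b ε := by
    intro ε hε
    have hpi := Real.pi_pos
    rw [totalAngle, ← integral_angleRate_eq hb hε.1 (hε.2.trans maxExcess_bounds.2),
      sqrt_three_div_two_mul_energy, ← (hpa ε hε.1).2.1, ← (hpb ε hε.1).2.1]
    congr 1
    refine intervalIntegral.integral_congr fun ψ hψ => ?_
    rw [Set.uIcc_of_le (by linarith)] at hψ
    have hu : 0 ≤ ε + logSin ψ := add_nonneg hε.1 (logSin_nonneg hψ.1 hψ.2)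
    simp only [angleRate]
    rw [energy_mul_sin hψ.1 hψ.2, ← (hpb _ hu).2.1, ← Real.exp_nat_mul]
    congr 3
    push_cast
    ring
  have hc0 : 0 < 2 / √3 := by positivity
  obtain ⟨ε, ⟨hε, hεπ⟩, huniq⟩ := existsUnique_totalAngle_eq_pi ha hb
  refine ⟨energy ε, ⟨⟨?_, ?_⟩, (htotal ε hε).trans hεπ⟩, ?_⟩
  · exact le_mul_of_one_le_right hc0.le (Real.one_le_exp hε.1)
  · rw [energy, ← Real.log_le_iff_le_exp (by positivity), Real.log_mul hc0.ne' (Real.exp_ne_zero _),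
      Real.log_exp]
    have := hε.2
    rw [maxExcess] at this
    linarith
  · rintro c ⟨⟨hc1, hc2⟩, hcπ⟩
    have hc : 0 < c := hc0.trans_le hc1
    have hce : energy (Real.log c - Real.log (2 / √3)) = c := by
      rw [energy, Real.exp_sub, Real.exp_log hc, Real.exp_log hc0]; field_simp
    have hmem : Real.log c - Real.log (2 / √3) ∈ Set.Icc 0 maxExcess :=
      ⟨sub_nonneg.2 (Real.log_le_log hc0 hc1),
        sub_le_sub_right ((Real.log_le_iff_le_exp hc).2 hc2) _⟩
    have heq := htotal _ hmem
    rw [hce, hcπ] at heq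
    rw [← huniq _ ⟨hmem, heq.symm⟩, hce]
end

section
/- For every c ≥ 2/√3, one has 2·h₁(c) + h₂(c) > π, where h₁(c) = ∫_{π/3}^{2π/3} (1 − R⁻(c·sin ψ)²)⁻¹ dψ and h₂(c) = ∫_{R⁻((√3/2)c)}^{R⁺((√3/2)c)} K(R)/(R·√(c² − K(R)²)) dR. -/
open Real

lemma K_one : K 1 = 1 := by simp [K]

lemma K_sq (R : ℝ) : K R ^ 2 = exp (R ^ 2 - 1) / R ^ 2 := by
  rw [K, div_pow, ← exp_nat_mul]
  congr 2
  push_cast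
  ring

lemma K_sqrt_sq {s : ℝ} (hs : 0 ≤ s) : K √s ^ 2 = exp (s - 1) / s := by
  rw [K_sq, sq_sqrt hs]

lemma hasDerivAt_K {R : ℝ} (hR : R ≠ 0) : HasDerivAt K (K R * (R - 1 / R)) R := by
  have h := ((((hasDerivAt_id R).pow 2).sub_const 1).div_const 2).exp.div (hasDerivAt_id R) hR
  refine h.congr_deriv ?_
  simp only [K, id, Pi.pow_apply]
  field_simp
  norm_num
  ring

lemma strictAntiOn_K : StrictAntiOn K (Set.Ioc 0 1) := by
  refine strictAntiOn_of_deriv_neg (convex_Ioc 0 1)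
    (continuousOn_K.mono fun x hx => hx.1) fun x hx => ?_
  rw [interior_Ioc] at hx
  rw [(hasDerivAt_K hx.1.ne').deriv]
  have : 1 < 1 / x := (one_lt_div hx.1).2 hx.2
  exact mul_neg_of_pos_of_neg (K_pos hx.1) (by linarith [hx.2])

lemma strictMonoOn_K : StrictMonoOn K (Set.Ici 1) := by
  refine strictMonoOn_of_deriv_pos (convex_Ici 1)
    (continuousOn_K.mono fun x hx => lt_of_lt_of_le (one_pos : (0 : ℝ) < 1) hx) fun x hx => ?_
  rw [interior_Ici] at hx
  have h0 : 0 < x := one_pos.trans hx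
  rw [(hasDerivAt_K h0.ne').deriv]
  have : 1 / x < 1 := (div_lt_one h0).2 hx
  exact mul_pos (K_pos h0) (by linarith [Set.mem_Ioi.1 hx])

lemma lt_sq_of_K_sq_lt {r s : ℝ} (hr : 0 < r) (hs : 0 < s) (hs1 : s ≤ 1)
    (h : K r ^ 2 < exp (s - 1) / s) : s < r ^ 2 := by
  by_contra! hle
  have hrs : r ≤ √s := le_sqrt_of_sq_le hle
  have hs' : √s ≤ 1 := sqrt_le_one.2 hs1
  have := strictAntiOn_K.antitoneOn ⟨hr, hrs.trans hs'⟩ ⟨sqrt_pos.2 hs, hs'⟩ hrs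
  rw [← K_sqrt_sq hs.le] at h
  exact absurd (pow_le_pow_left₀ (K_pos (sqrt_pos.2 hs)).le this 2) (not_le.2 h)

lemma sq_le_of_le_K_sq {r s : ℝ} (hr : 0 < r) (hr1 : r ≤ 1) (hs : 0 < s)
    (h : exp (s - 1) / s ≤ K r ^ 2) : r ^ 2 ≤ s := by
  by_contra! hlt
  have hrs : √s < r := (sqrt_lt' hr).2 hlt
  have := strictAntiOn_K ⟨sqrt_pos.2 hs, hrs.le.trans hr1⟩ ⟨hr, hr1⟩ hrs
  rw [← K_sqrt_sq hs.le] at h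
  exact absurd (pow_lt_pow_left₀ this (K_pos hr).le two_ne_zero) (not_lt.2 h)

lemma le_sq_of_le_K_sq {r s : ℝ} (hr : 1 ≤ r) (hs : 1 ≤ s)
    (h : exp (s - 1) / s ≤ K r ^ 2) : s ≤ r ^ 2 := by
  by_contra! hlt
  have hrs : r < √s := lt_sqrt_of_sq_lt hlt
  have := strictMonoOn_K hr (one_le_sqrt.2 hs) hrs
  rw [← K_sqrt_sq (by linarith)] at h
  exact absurd (pow_lt_pow_left₀ this (K_pos (by linarith)).le two_ne_zero) (not_lt.2 h)

/-- Near its minimum, `K ^ 2 - 1` is at most quadratic in `1 - R ^ 2`. -/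
lemma K_sq_sub_one_le {R : ℝ} (hR : 0 < R) (hR1 : R ≤ 1) :
    (K R ^ 2 - 1) * R ^ 2 ≤ (1 - R ^ 2) ^ 2 := by
  have hR2 : 0 < R ^ 2 := by positivity
  have hle : R ^ 2 ≤ 1 := pow_le_one₀ hR.le hR1
  rw [K_sq, sub_mul, div_mul_cancel₀ _ hR2.ne']
  have h1 : exp (R ^ 2 - 1) * (2 - R ^ 2) ≤ 1 := by
    have := mul_le_mul_of_nonneg_left (add_one_le_exp (1 - R ^ 2)) (exp_pos (R ^ 2 - 1)).le
    rw [← exp_add] at this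
    ring_nf at this ⊢
    simpa using this
  nlinarith [pow_nonneg (sub_nonneg.2 hle) 3]

lemma arctan_le_tangent {a t : ℝ} (ha : 0 ≤ a) (ht : 0 ≤ t) :
    arctan t ≤ arctan a + (t - a) / (1 + a ^ 2) := by
  have hd : ∀ x, deriv arctan x = 1 / (1 + x ^ 2) := fun x => (hasDerivAt_arctan x).deriv
  rcases le_total a t with h | h
  · have := (convex_Icc a t).image_sub_le_mul_sub_of_deriv_le continuous_arctan.continuousOn
      differentiable_arctan.differentiableOn (C := 1 / (1 + a ^ 2)) (fun x hx => by
        rw [interior_Icc] at hx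
        rw [hd]
        have := hx.1
        gcongr) a (Set.left_mem_Icc.2 h) t (Set.right_mem_Icc.2 h) h
    rw [div_mul_eq_mul_div, one_mul] at this
    linarith
  · have := (convex_Icc t a).mul_sub_le_image_sub_of_le_deriv continuous_arctan.continuousOn
      differentiable_arctan.differentiableOn (C := 1 / (1 + a ^ 2)) (fun x hx => by
        rw [interior_Icc] at hx
        rw [hd]
        have := hx.1
        have := hx.2
        gcongr
        linarith) t (Set.left_mem_Icc.2 h) a (Set.right_mem_Icc.2 h) h
    have h2 : 1 / (1 + a ^ 2) * (a - t) = -((t - a) / (1 + a ^ 2)) := by ring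
    linarith

lemma four_thirds_sin_sq_sub_one_ge {t : ℝ} (ht : 0 ≤ t) (ht' : t ≤ π / 6) :
    t / 3 ≤ 4 / 3 * sin (π / 3 + t) ^ 2 - 1 := by
  have hs : 2 / π * t ≤ sin t := mul_le_sin ht (by linarith [pi_pos])
  have hs0 : t / 2 ≤ sin t := by
    refine le_trans ?_ hs
    rw [div_mul_eq_mul_div, le_div_iff₀ pi_pos]
    nlinarith [pi_le_four]
  have hs1 : sin t ≤ 1 / 2 := by
    rw [← sin_pi_div_six]
    exact sin_le_sin_of_le_of_le_pi_div_two (by linarith [pi_pos]) (by linarith [pi_pos]) ht'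
  have hc : √3 / 2 ≤ cos t := by
    rw [← cos_pi_div_six]
    exact cos_le_cos_of_nonneg_of_le_pi ht (by linarith [pi_pos]) ht'
  have h3 : √3 ^ 2 = 3 := sq_sqrt (by norm_num)
  have h30 : 0 ≤ √3 := sqrt_nonneg 3
  rw [sin_add, sin_pi_div_three, cos_pi_div_three]
  have hcs : cos t ^ 2 = 1 - sin t ^ 2 := by rw [cos_sq']
  have h4 : 3 / 2 ≤ √3 * cos t := by nlinarith
  have h5 : sin t * 1 ≤ sin t * (√3 * cos t - sin t) :=
    mul_le_mul_of_nonneg_left (by linarith) (by linarith)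
  have : 4 / 3 * (√3 / 2 * cos t + 1 / 2 * sin t) ^ 2 - 1
      = 2 / 3 * (sin t * (√3 * cos t - sin t)) := by
    linear_combination (1 / 3 * cos t ^ 2) * h3 + hcs
  linarith

lemma le_of_K_le {r s : ℝ} (hr : 0 < r) (hr1 : r ≤ 1) (hs : 0 < s) (hs1 : s ≤ 1)
    (h : K r ≤ K s) : s ≤ r :=
  (strictAntiOn_K.le_iff_ge ⟨hr, hr1⟩ ⟨hs, hs1⟩).1 h

lemma one_lt_mul_sin {c ψ : ℝ} (hc : 2 / √3 ≤ c) (h1 : π / 3 < ψ) (h2 : ψ < 2 * π / 3) :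
    1 < c * sin ψ := by
  have h3 : 0 < √3 := by positivity
  have hsin : √3 / 2 < sin ψ := by
    have hcos : √3 / 2 < cos (ψ - π / 2) := by
      rw [← cos_pi_div_six, ← cos_abs (ψ - π / 2)]
      refine cos_lt_cos_of_nonneg_of_le_pi (abs_nonneg _) (by linarith [pi_pos]) ?_
      rw [abs_lt]
      constructor <;> linarith
    rwa [cos_sub_pi_div_two] at hcos
  calc (1 : ℝ) = 2 / √3 * (√3 / 2) := by field_simp
    _ < 2 / √3 * sin ψ := by gcongr
    _ ≤ c * sin ψ := by
      gcongr
      exact (by positivity : 0 ≤ √3 / 2).trans hsin.le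

lemma one_lt_of_two_div_sqrt_three_le {c : ℝ} (hc : 2 / √3 ≤ c) : 1 < c := by
  have := one_lt_mul_sin hc (ψ := π / 2) (by linarith [pi_pos]) (by linarith [pi_pos])
  rwa [sin_pi_div_two, mul_one] at this

lemma four_thirds_le_sq {c : ℝ} (hc : 2 / √3 ≤ c) : 4 / 3 ≤ c ^ 2 := by
  have := pow_le_pow_left₀ (by positivity) hc 2
  rw [div_pow, sq_sqrt (by norm_num)] at this
  linarith

lemma inner_branch_antitone {Rm : ℝ → ℝ}
    (hRm : ∀ x : ℝ, 1 < x → 0 < Rm x ∧ Rm x < 1 ∧ K (Rm x) = x)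
    {x y : ℝ} (hx : 1 < x) (hxy : x ≤ y) :
    Rm y ≤ Rm x := by
  obtain ⟨h1, h2, h3⟩ := hRm x hx
  obtain ⟨h4, h5, h6⟩ := hRm y (hx.trans_le hxy)
  exact le_of_K_le h1 h2.le h4 h5.le (by rw [h3, h6]; exact hxy)

lemma inv_one_sub_sq_anti {Rm : ℝ → ℝ}
    (hRm : ∀ x : ℝ, 1 < x → 0 < Rm x ∧ Rm x < 1 ∧ K (Rm x) = x)
    {x y : ℝ} (hx : 1 < x) (hxy : x ≤ y) :
    (1 - Rm y ^ 2)⁻¹ ≤ (1 - Rm x ^ 2)⁻¹ := by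
  obtain ⟨h1, h2, -⟩ := hRm x hx
  obtain ⟨h4, -, -⟩ := hRm y (hx.trans_le hxy)
  have h : 0 < 1 - Rm x ^ 2 := by nlinarith
  have := pow_le_pow_left₀ h4.le (inner_branch_antitone hRm hx hxy) 2
  gcongr

lemma intervalIntegrable_left {Rm : ℝ → ℝ}
    (hRm : ∀ x : ℝ, 1 < x → 0 < Rm x ∧ Rm x < 1 ∧ K (Rm x) = x)
    {c : ℝ} (hc : 2 / √3 ≤ c) :
    IntervalIntegrable (fun ψ => (1 - Rm (c * sin ψ) ^ 2)⁻¹) MeasureTheory.volume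
      (π / 3) (π / 2) := by
  have hπ := pi_pos
  have hc1 := one_lt_of_two_div_sqrt_three_le hc
  obtain ⟨hs0, hs1, -⟩ := hRm c hc1
  set s := Rm c
  have hg : IntervalIntegrable (fun ψ => (√(s ^ 2 / 3))⁻¹ * (ψ - π / 3) ^ (-(1 / 2) : ℝ))
      MeasureTheory.volume (π / 3) (π / 2) := by
    have h := (intervalIntegral.intervalIntegrable_rpow' (a := 0) (b := π / 2 - π / 3)
      (r := -(1 / 2)) (by norm_num)).comp_sub_right (π / 3)
    rw [zero_add, sub_add_cancel] at h
    exact h.const_mul _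
  have hIoc : Set.uIoc (π / 3) (π / 2) = Set.Ioc (π / 3) (π / 2) :=
    Set.uIoc_of_le (by linarith)
  refine hg.mono_fun' ?_ ?_
  · rw [hIoc]
    refine (aemeasurable_restrict_of_antitoneOn measurableSet_Ioc
      fun x hx y hy hxy => ?_).aestronglyMeasurable
    refine inv_one_sub_sq_anti hRm (one_lt_mul_sin hc hx.1 (by linarith [hx.2])) ?_
    gcongr
    exact sin_le_sin_of_le_of_le_pi_div_two (by linarith [hx.1]) hy.2 hxy
  · rw [hIoc]
    refine (MeasureTheory.ae_restrict_iff' measurableSet_Ioc).2 (.of_forall fun ψ hψ => ?_)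
    have hx := one_lt_mul_sin hc hψ.1 (by linarith [hψ.2])
    obtain ⟨h1, h2, h3⟩ := hRm _ hx
    have hsR : s ≤ Rm (c * sin ψ) := inner_branch_antitone hRm hx
      (mul_le_of_le_one_right (by linarith) (sin_le_one ψ))
    have hu : 0 < 1 - Rm (c * sin ψ) ^ 2 := by nlinarith
    have hquad := K_sq_sub_one_le h1 h2.le
    rw [h3] at hquad
    have ht : 0 < ψ - π / 3 := sub_pos.2 hψ.1
    have hsin := four_thirds_sin_sq_sub_one_ge ht.le (by linarith [hψ.2])
    rw [add_sub_cancel] at hsin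
    have hlow : s ^ 2 / 3 * (ψ - π / 3) ≤ (1 - Rm (c * sin ψ) ^ 2) ^ 2 := by
      have h43 := mul_le_mul_of_nonneg_right (four_thirds_le_sq hc) (sq_nonneg (sin ψ))
      have hp : (ψ - π / 3) / 3 ≤ (c * sin ψ) ^ 2 - 1 := by rw [mul_pow]; linarith
      have hsq := pow_le_pow_left₀ hs0.le hsR 2
      calc s ^ 2 / 3 * (ψ - π / 3) = (ψ - π / 3) / 3 * s ^ 2 := by ring
        _ ≤ ((c * sin ψ) ^ 2 - 1) * Rm (c * sin ψ) ^ 2 := by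
          gcongr
          exact (by positivity : 0 ≤ (ψ - π / 3) / 3).trans hp
        _ ≤ _ := hquad
    beta_reduce
    rw [norm_of_nonneg (inv_nonneg.2 hu.le), rpow_neg ht.le, ← sqrt_eq_rpow, ← mul_inv,
      ← sqrt_mul (by positivity)]
    have hpos : 0 < √(s ^ 2 / 3 * (ψ - π / 3)) := sqrt_pos.2 (by positivity)
    have := (sqrt_le_left hu.le).2 hlow
    gcongr

lemma intervalIntegrable_inv_one_sub_sq {Rm : ℝ → ℝ}
    (hRm : ∀ x : ℝ, 1 < x → 0 < Rm x ∧ Rm x < 1 ∧ K (Rm x) = x)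
    {c : ℝ} (hc : 2 / √3 ≤ c) :
    IntervalIntegrable (fun ψ => (1 - Rm (c * sin ψ) ^ 2)⁻¹) MeasureTheory.volume
      (π / 3) (2 * π / 3) := by
  have hl := intervalIntegrable_left hRm hc
  refine hl.trans ?_
  have hr := hl.comp_sub_left π
  simp only [sin_pi_sub] at hr
  convert hr.symm using 1 <;> ring

lemma integral_inv_one_sub_sq_ge {Rm : ℝ → ℝ}
    (hRm : ∀ x : ℝ, 1 < x → 0 < Rm x ∧ Rm x < 1 ∧ K (Rm x) = x)
    {c : ℝ} (hc : 2 / √3 ≤ c) :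
    π / 3 * (1 - Rm c ^ 2)⁻¹ ≤
      ∫ ψ in (π / 3)..(2 * π / 3), (1 - Rm (c * sin ψ) ^ 2)⁻¹ := by
  have hπ := pi_pos
  have h := intervalIntegral.integral_mono_on_of_le_Ioo (a := π / 3) (b := 2 * π / 3)
    (by linarith) (intervalIntegrable_const (c := (1 - Rm c ^ 2)⁻¹))
    (intervalIntegrable_inv_one_sub_sq hRm hc) fun ψ hψ =>
      inv_one_sub_sq_anti hRm (one_lt_mul_sin hc hψ.1 hψ.2)
        (mul_le_of_le_one_right (by linarith [one_lt_of_two_div_sqrt_three_le hc]) (sin_le_one ψ))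
  rw [intervalIntegral.integral_const, smul_eq_mul] at h
  convert h using 2
  ring

lemma K_le_of_mem_Icc {a b y R : ℝ} (ha : 0 < a) (ha1 : a ≤ 1) (hKa : K a = y)
    (hKb : K b = y) (hR : R ∈ Set.Icc a b) : K R ≤ y := by
  rcases le_total R 1 with h | h
  · rw [← hKa]
    exact strictAntiOn_K.antitoneOn ⟨ha, ha1⟩ ⟨ha.trans_le hR.1, h⟩ hR.1
  · rw [← hKb]
    exact strictMonoOn_K.monotoneOn h (h.trans hR.2) hR.2

lemma one_div_sqrt_le_K_div_sqrt {c R : ℝ} (hR : 0 < R) (hc : K R < c) :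
    1 / √(c ^ 2 - 1) ≤ K R / √(c ^ 2 - K R ^ 2) := by
  have h1 := one_le_K hR
  have hpos : 0 < √(c ^ 2 - K R ^ 2) := sqrt_pos.2 (by nlinarith)
  gcongr
  nlinarith

lemma hasDerivAt_arcsin_K_div {c R : ℝ} (hR : 0 < R) (hc : K R < c) :
    HasDerivAt (fun R => arcsin (K R / c))
      (K R / √(c ^ 2 - K R ^ 2) * (R - 1 / R)) R := by
  have hK := K_pos hR
  have hc0 : 0 < c := hK.trans hc
  have h1 : K R / c < 1 := (div_lt_one hc0).2 hc
  have h0 : 0 < K R / c := div_pos hK hc0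
  have hs : √(1 - (K R / c) ^ 2) = √(c ^ 2 - K R ^ 2) / c := by
    rw [← sqrt_sq hc0.le, ← sqrt_div' _ (sq_nonneg c), sqrt_sq hc0.le]
    congr 1
    field_simp
  have h := (hasDerivAt_arcsin (by linarith) h1.ne).comp R ((hasDerivAt_K hR.ne').div_const c)
  refine h.congr_deriv ?_
  rw [hs]
  have hpos : 0 < √(c ^ 2 - K R ^ 2) := sqrt_pos.2 (by nlinarith)
  field_simp

lemma continuousOn_outer_integrand {c : ℝ} {s : Set ℝ} (hs : ∀ R ∈ s, 0 < R ∧ K R < c) :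
    ContinuousOn (fun R => K R / (R * √(c ^ 2 - K R ^ 2))) s := by
  have hK : ContinuousOn K s := continuousOn_K.mono fun R hR => (hs R hR).1
  refine hK.div (continuousOn_id.mul (continuousOn_const.sub (hK.pow 2)).sqrt) fun R hR => ?_
  obtain ⟨h0, h1⟩ := hs R hR
  exact (mul_pos h0 (sqrt_pos.2 (by nlinarith [K_pos h0]))).ne'

lemma integral_outer_ge {a b y c : ℝ} (ha : 0 < a) (ha1 : a ≤ 1) (hb1 : 1 ≤ b)
    (hKa : K a = y) (hKb : K b = y) (hyc : y < c) :
    arcsin (y / c) - arcsin (1 / c) + 1 / √(c ^ 2 - 1) * ((1 - a ^ 2) / 2 + log b) ≤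
      ∫ R in a..b, K R / (R * √(c ^ 2 - K R ^ 2)) := by
  have hmem : ∀ R ∈ Set.Icc a b, 0 < R ∧ K R < c := fun R hR =>
    ⟨ha.trans_le hR.1, (K_le_of_mem_Icc ha ha1 hKa hKb hR).trans_lt hyc⟩
  have hl : ∀ R ∈ Set.Icc a 1, 0 < R ∧ K R < c := fun R hR =>
    hmem R ⟨hR.1, hR.2.trans hb1⟩
  have hr : ∀ R ∈ Set.Icc 1 b, 0 < R ∧ K R < c := fun R hR =>
    hmem R ⟨ha1.trans hR.1, hR.2⟩
  have hcl := continuousOn_outer_integrand hl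
  have hcr := continuousOn_outer_integrand hr
  set T := 1 / √(c ^ 2 - 1) with hT
  have hleft := intervalIntegral.sub_le_integral_of_hasDeriv_right_of_le
    (g := fun R => T * (R ^ 2 / 2) - arcsin (K R / c))
    (g' := fun R => T * R - K R / √(c ^ 2 - K R ^ 2) * (R - 1 / R)) ha1
    (by
      have hK : ContinuousOn K (Set.Icc a 1) := continuousOn_K.mono fun R hR => (hl R hR).1
      exact ContinuousOn.sub (by fun_prop)
        (continuous_arcsin.comp_continuousOn (hK.div_const c)))
    (fun R hR => by
      have hR' := hl R (Set.Ioo_subset_Icc_self hR)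
      refine HasDerivAt.hasDerivWithinAt
        (HasDerivAt.sub ?_ (hasDerivAt_arcsin_K_div hR'.1 hR'.2))
      refine ((((hasDerivAt_id R).pow 2).div_const 2).const_mul T).congr_deriv ?_
      simp)
    hcl.integrableOn_Icc
    (fun R hR => by
      have hR' := hl R (Set.Ioo_subset_Icc_self hR)
      have hw := mul_le_mul_of_nonneg_right (one_div_sqrt_le_K_div_sqrt hR'.1 hR'.2) hR'.1.le
      have he : K R / (R * √(c ^ 2 - K R ^ 2)) = K R / √(c ^ 2 - K R ^ 2) * (1 / R) := by
        rw [div_mul_div_comm, mul_one, mul_comm R]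
      rw [he]
      linarith)
  have hright := intervalIntegral.sub_le_integral_of_hasDeriv_right_of_le
    (g := fun R => T * log R) (g' := fun R => T * R⁻¹) hb1
    (continuousOn_const.mul (continuousOn_log.mono fun R hR => (hr R hR).1.ne'))
    (fun R hR => ((hasDerivAt_log (hr R (Set.Ioo_subset_Icc_self hR)).1.ne').const_mul
      T).hasDerivWithinAt)
    hcr.integrableOn_Icc
    (fun R hR => by
      have hR' := hr R (Set.Ioo_subset_Icc_self hR)
      have hw := mul_le_mul_of_nonneg_right (one_div_sqrt_le_K_div_sqrt hR'.1 hR'.2)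
        (inv_nonneg.2 hR'.1.le)
      refine hw.trans_eq ?_
      rw [← div_eq_mul_inv, div_div, mul_comm R])
  have hsplit := intervalIntegral.integral_add_adjacent_intervals
    (hcl.intervalIntegrable_of_Icc (μ := MeasureTheory.volume) ha1)
    (hcr.intervalIntegrable_of_Icc (μ := MeasureTheory.volume) hb1)
  rw [← hsplit]
  rw [hKa, K_one] at hleft
  rw [log_one] at hright
  linarith

lemma arcsin_one_div_eq_arctan {c : ℝ} (hc : 1 < c) :
    arcsin (1 / c) = arctan (1 / √(c ^ 2 - 1)) := by
  have hc0 : 0 < c := by linarith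
  have h0 : 0 < 1 / c := by positivity
  rw [arcsin_eq_arctan ⟨by linarith, (div_lt_one hc0).2 hc⟩]
  congr 1
  have hs : √(1 - (1 / c) ^ 2) = √(c ^ 2 - 1) / c := by
    rw [← sqrt_sq hc0.le, ← sqrt_div' _ (sq_nonneg c), sqrt_sq hc0.le]
    congr 1
    field_simp
  rw [hs]
  have hpos : 0 < √(c ^ 2 - 1) := sqrt_pos.2 (by nlinarith)
  field_simp

lemma integral_outer_branches_ge {Rm Rp : ℝ → ℝ}
    (hRm : ∀ x : ℝ, 1 < x → 0 < Rm x ∧ Rm x < 1 ∧ K (Rm x) = x)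
    (hRp : ∀ x : ℝ, 1 < x → 1 < Rp x ∧ K (Rp x) = x) {c : ℝ} (hc : 1 < √3 / 2 * c) :
    π / 3 - arctan (1 / √(c ^ 2 - 1)) +
        1 / √(c ^ 2 - 1) * ((1 - Rm (√3 / 2 * c) ^ 2) / 2 + log (Rp (√3 / 2 * c))) ≤
      ∫ R in (Rm (√3 / 2 * c))..(Rp (√3 / 2 * c)), K R / (R * √(c ^ 2 - K R ^ 2)) := by
  obtain ⟨h1, h2, h3⟩ := hRm _ hc
  obtain ⟨h4, h5⟩ := hRp _ hc
  have hlt : √3 / 2 < 1 := by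
    have : √3 < 2 := (sqrt_lt' two_pos).2 (by norm_num)
    linarith
  have hc0 : 0 < c := pos_of_mul_pos_right (one_pos.trans hc) (by positivity)
  have hyc : √3 / 2 * c < c := mul_lt_of_lt_one_left hc0 hlt
  have h := integral_outer_ge h1 h2.le h4.le h3 h5 hyc
  rw [mul_div_cancel_right₀ _ hc0.ne', arcsin_one_div_eq_arctan (hc.trans hyc),
    ← sin_pi_div_three, arcsin_sin (by linarith [pi_pos]) (by linarith [pi_pos])] at h
  rwa [sin_pi_div_three] at h

lemma exp_le_of_pow_le (p q : ℕ) {x v : ℝ} (hq : q ≠ 0) (hx : q * x = p) (hv : 0 ≤ v)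
    (h : (2.7182818286 : ℝ) ^ p ≤ v ^ q) : exp x ≤ v := by
  refine le_of_pow_le_pow_left₀ hq hv (le_trans ?_ h)
  rw [← exp_nat_mul, hx, ← mul_one (p : ℝ), exp_nat_mul]
  exact pow_le_pow_left₀ (exp_pos _).le exp_one_lt_d9.le p

lemma le_exp_of_pow_le (p q : ℕ) {x v : ℝ} (hq : q ≠ 0) (hx : q * x = p)
    (h : v ^ q ≤ (2.7182818283 : ℝ) ^ p) : v ≤ exp x := by
  refine le_of_pow_le_pow_left₀ hq (exp_pos _).le (h.trans ?_)
  rw [← exp_nat_mul, hx, ← mul_one (p : ℝ), exp_nat_mul]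
  exact pow_le_pow_left₀ (by norm_num) exp_one_gt_d9.le p

lemma lt_exp_sub_one_div {s x v : ℝ} (hs : 0 < s) (hx : 0 < x) (hv : exp (1 - s) ≤ v)
    (h : x * s * v < 1) : x < exp (s - 1) / s := by
  rw [lt_div_iff₀ hs, ← neg_sub, exp_neg, ← one_div, lt_div_iff₀ (exp_pos _)]
  exact (mul_le_mul_of_nonneg_left hv (by positivity)).trans_lt h

lemma exp_sub_one_div_le {s x v : ℝ} (hs : 0 < s) (hx : 0 < x) (hv : v ≤ exp (1 - s))
    (h : 1 ≤ x * s * v) : exp (s - 1) / s ≤ x := by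
  rw [div_le_iff₀ hs, ← neg_sub, exp_neg, ← one_div, div_le_iff₀ (exp_pos _)]
  exact h.trans (mul_le_mul_of_nonneg_left hv (by positivity))

lemma le_log_of_exp_le_sq {l r : ℝ} (hr : 0 < r) (h : exp (2 * l) ≤ r ^ 2) : l ≤ log r := by
  have := (le_log_iff_exp_le (by positivity)).2 h
  rw [log_pow] at this
  push_cast at this
  linarith

lemma inv_one_sub_le_inv {s r : ℝ} (h : s ≤ r) (hr : r < 1) : (1 - s)⁻¹ ≤ (1 - r)⁻¹ := by
  have : 0 < 1 - r := by linarith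
  gcongr

theorem stmt_16 (Rm Rp : ℝ → ℝ)
    (hRm : ∀ x : ℝ, 1 < x → 0 < Rm x ∧ Rm x < 1 ∧ K (Rm x) = x)
    (hRp : ∀ x : ℝ, 1 < x → 1 < Rp x ∧ K (Rp x) = x)
    (hRm1 : Rm 1 = 1) (hRp1 : Rp 1 = 1)
    (c : ℝ) (hc : 2 / Real.sqrt 3 ≤ c) :
    2 * (∫ ψ in (π / 3)..(2 * π / 3), (1 - (Rm (c * Real.sin ψ)) ^ 2)⁻¹) +
      (∫ R in (Rm (Real.sqrt 3 / 2 * c))..(Rp (Real.sqrt 3 / 2 * c)),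
        K R / (R * Real.sqrt (c ^ 2 - (K R) ^ 2))) > π := by
  have hpi := pi_gt_d4
  have hpi' := pi_lt_d4
  have hc1 := one_lt_of_two_div_sqrt_three_le hc
  have hin := integral_inv_one_sub_sq_ge hRm hc
  obtain ⟨hm0, hm1, hKm⟩ := hRm c hc1
  have hm2 : Rm c ^ 2 < 1 := by nlinarith
  set h₁ := ∫ ψ in (π / 3)..(2 * π / 3), (1 - (Rm (c * Real.sin ψ)) ^ 2)⁻¹
  have hin_of {s : ℝ} (hs : s ≤ Rm c ^ 2) : π / 3 * (1 - s)⁻¹ ≤ h₁ :=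
    le_trans (by have := inv_one_sub_le_inv hs hm2; gcongr) hin
  have hin_gt {s : ℝ} (hs : 0 < s) (hs1 : s ≤ 1) (h : c ^ 2 < exp (s - 1) / s) :
      s < Rm c ^ 2 := lt_sq_of_K_sq_lt hm0 hs hs1 (by rwa [hKm])
  have hy2 : (√3 / 2 * c) ^ 2 = 3 / 4 * c ^ 2 := by
    rw [mul_pow, div_pow, sq_sqrt (by norm_num)]
    norm_num
  rcases le_or_gt (c ^ 2) 1.52 with hA | hA
  · have h1 := hin_of (hin_gt (s := 67 / 200) (by norm_num) (by norm_num)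
      (hA.trans_lt (lt_exp_sub_one_div (v := 1.947) (by norm_num) (by norm_num)
        (exp_le_of_pow_le 133 200
        (by norm_num) (by norm_num) (by norm_num) (by norm_num)) (by norm_num)))).le
    have h2 : 0 ≤ ∫ R in (Rm (√3 / 2 * c))..(Rp (√3 / 2 * c)),
        K R / (R * √(c ^ 2 - K R ^ 2)) := by
      have hy1 : 1 ≤ √3 / 2 * c :=
        (sq_le_sq₀ zero_le_one (by positivity)).1 (by
          rw [hy2]; linarith [four_thirds_le_sq hc])
      rcases hy1.eq_or_lt with h | h
      · rw [← h, hRm1, hRp1, intervalIntegral.integral_same]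
      · obtain ⟨ha0, ha1, -⟩ := hRm _ h
        refine intervalIntegral.integral_nonneg (ha1.le.trans (hRp _ h).1.le) fun R hR => ?_
        have hR0 := ha0.trans_le hR.1
        have := K_pos hR0
        positivity
    norm_num at h1
    linarith
  have hy : 1 < √3 / 2 * c := by
    have h0 : 0 ≤ √3 / 2 * c := by positivity
    nlinarith
  have hout := integral_outer_branches_ge hRm hRp hy
  obtain ⟨ha0, ha1, hKa⟩ := hRm _ hy
  obtain ⟨hb1, hKb⟩ := hRp _ hy
  set a := Rm (√3 / 2 * c)
  set b := Rp (√3 / 2 * c)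
  set h₂ := ∫ R in a..b, K R / (R * √(c ^ 2 - K R ^ 2))
  have ha_le {s : ℝ} (hs : 0 < s) (h : exp (s - 1) / s ≤ 3 / 4 * c ^ 2) : a ^ 2 ≤ s :=
    sq_le_of_le_K_sq ha0 ha1.le hs (by rwa [hKa, hy2])
  have hb_ge {s : ℝ} (hs : 1 ≤ s) (h : exp (s - 1) / s ≤ 3 / 4 * c ^ 2) : s ≤ b ^ 2 :=
    le_sq_of_le_K_sq hb1.le hs (by rwa [hKb, hy2])
  have hT0 : 0 < 1 / √(c ^ 2 - 1) := one_div_pos.2 (sqrt_pos.2 (by linarith))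
  have hT2 : (1 / √(c ^ 2 - 1)) ^ 2 = 1 / (c ^ 2 - 1) := by
    rw [div_pow, sq_sqrt (by linarith), one_pow]
  set T := 1 / √(c ^ 2 - 1)
  have hT_self : arctan T ≤ T := by
    simpa using arctan_le_tangent le_rfl hT0.le
  have hT_le {q t : ℝ} (hq : q < c ^ 2) (hq1 : 1 < q) (ht : 0 ≤ t)
      (h : 1 ≤ t ^ 2 * (q - 1)) : T ≤ t := by
    refine le_of_sq_le_sq ?_ ht
    rw [hT2, div_le_iff₀ (by linarith)]
    nlinarith [mul_le_mul_of_nonneg_left hq.le (sq_nonneg t)]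
  rcases le_or_gt (c ^ 2) 2.68 with hB | hB
  · have ha := ha_le (s := 59 / 100) (by norm_num) ((exp_sub_one_div_le (x := 1.52 * 3 / 4)
      (v := 1.506) (by norm_num) (by norm_num) (le_exp_of_pow_le 41 100 (by norm_num)
        (by norm_num) (by norm_num))
      (by norm_num)).trans (by linarith))
    have hb := hb_ge (s := 79 / 50) (by norm_num) (by
      rw [div_le_iff₀ (by norm_num)]
      have : exp (79 / 50 - 1) ≤ 1.787 := (exp_le_of_pow_le 29 50 (by norm_num) (by norm_num)
        (by norm_num) (by norm_num))
      linarith)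
    have hlog := le_log_of_exp_le_sq (l := 9 / 40) (by linarith)
      ((exp_le_of_pow_le 9 20 (by norm_num) (by norm_num)
        (by norm_num) (by norm_num)).trans hb)
    have h1 := hin_of (hin_gt (s := 4 / 25) (by norm_num) (by norm_num)
      (hB.trans_lt (lt_exp_sub_one_div (v := 2.317) (by norm_num) (by norm_num)
        (exp_le_of_pow_le 21 25 (by norm_num) (by norm_num)
        (by norm_num) (by norm_num)) (by norm_num)))).le
    norm_num at h1
    have hS : T * (43 / 100) ≤ T * ((1 - a ^ 2) / 2 + log b) :=
      mul_le_mul_of_nonneg_left (by linarith) hT0.le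
    have hT := hT_le (q := 1.52) (t := 1.39) hA (by norm_num) (by norm_num) (by norm_num)
    have htan := arctan_le_tangent zero_le_one hT0.le
    rw [arctan_one] at htan
    linarith
  rcases le_or_gt (c ^ 2) 5 with hC | hC
  · have ha := ha_le (s := 6 / 25) (by norm_num) ((exp_sub_one_div_le (x := 2.68 * 3 / 4)
      (v := 2.138) (by norm_num) (by norm_num) (le_exp_of_pow_le 19 25 (by norm_num)
        (by norm_num) (by norm_num))
      (by norm_num)).trans (by linarith))
    have hb := hb_ge (s := 13 / 5) (by norm_num) (by
      rw [div_le_iff₀ (by norm_num)]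
      have : exp (13 / 5 - 1) ≤ 4.954 := (exp_le_of_pow_le 8 5 (by norm_num) (by norm_num)
        (by norm_num) (by norm_num))
      linarith)
    have hlog := le_log_of_exp_le_sq (l := 19 / 40) (by linarith)
      ((exp_le_of_pow_le 19 20 (by norm_num) (by norm_num)
        (by norm_num) (by norm_num)).trans hb)
    have h1 := hin_of (hin_gt (s := 7 / 100) (by norm_num) (by norm_num)
      (hC.trans_lt (lt_exp_sub_one_div (v := 2.535) (by norm_num) (by norm_num)
        (exp_le_of_pow_le 93 100 (by norm_num) (by norm_num)
        (by norm_num) (by norm_num)) (by norm_num)))).le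
    norm_num at h1
    have hS : T * (171 / 200) ≤ T * ((1 - a ^ 2) / 2 + log b) :=
      mul_le_mul_of_nonneg_left (by linarith) hT0.le
    have hT := hT_le (q := 2.68) (t := 0.78) hB (by norm_num) (by norm_num) (by norm_num)
    linarith
  have ha := ha_le (s := 1 / 5) (by norm_num) ((exp_sub_one_div_le (x := 5 * 3 / 4)
    (v := 2.225) (by norm_num) (by norm_num) (le_exp_of_pow_le 4 5 (by norm_num)
      (by norm_num) (by norm_num))
    (by norm_num)).trans (by linarith))
  have hb := hb_ge (s := 17 / 5) (by norm_num) (by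
    rw [div_le_iff₀ (by norm_num)]
    have : exp (17 / 5 - 1) ≤ 11.024 := (exp_le_of_pow_le 12 5 (by norm_num) (by norm_num)
      (by norm_num) (by norm_num))
    linarith)
  have hlog := le_log_of_exp_le_sq (l := 3 / 5) (by linarith)
    ((exp_le_of_pow_le 6 5 (by norm_num) (by norm_num)
      (by norm_num) (by norm_num)).trans hb)
  have hS : T * 1 ≤ T * ((1 - a ^ 2) / 2 + log b) :=
    mul_le_mul_of_nonneg_left (by linarith) hT0.le
  have h1 : π / 3 < h₁ := by
    refine lt_of_lt_of_le ?_ hin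
    have : 1 < (1 - Rm c ^ 2)⁻¹ :=
      (one_lt_inv₀ (by linarith)).2 (by linarith [pow_pos hm0 2])
    nlinarith
  linarith
end
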